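/- arXiv:2510.20765 — 2 statements merged into one kernel-verified Lean document; each statement's English description precedes it below -/
import Mathlib

section
/- There is c* > 0 such that for every ε ∈ (0,1] and every σ ∈ (0, c*] there is C > 0 such that for every c > 0 there is n₀ ∈ ℕ with the following property for all n ≥ n₀. Let d ≥ C·log n with dn even, let λ, μ satisfy (log n)^{−3} ≤ λ ≤ c* and (log n)^{−3} ≤ μ ≤ c*, let m be an integer with ε·d·n ≤ m ≤ n^{1+σ}, set δ = 2m/n and suppose λ²·μ·δ ≥ C·log n; set p = m·(binom(n,2) − dn/2)^{−1}. Let K ~ G_d(n), form E by including each element of [n]^(2)∖E(K) independently with probability p, and let F = K + E. Then with probability at least 1 − c·n^{−14}: for all disjoint sets U, V ⊆ [n] with |U|, |V| ≥ μ·n, (1 − 3λ)·p·|U|·|V| ≤ e_{F∖K}(U,V) ≤ (1 + 3λ)·p·|U|·|V|. (Lemma 6.9.) -/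
open scoped Classical ENNReal

noncomputable section

namespace Sandwich

variable {n : ℕ}

/-- The degree of the vertex `v` in the graph `G`. -/
def deg (G : SimpleGraph (Fin n)) (v : Fin n) : ℕ := Nat.card (G.neighborSet v)

/-- `G` is a `d`-regular graph. -/
def IsRegularGraph (G : SimpleGraph (Fin n)) (d : ℕ) : Prop := ∀ v, deg G v = d

/-- The number of edges of `G`. -/
def edgeCount (G : SimpleGraph (Fin n)) : ℕ := G.edgeSet.ncard

/-- The probability of the event `P` under the probability mass function `μ`. -/
def prEvent {α : Type*} (μ : PMF α) (P : α → Prop) : ℝ≥0∞ := ∑' a, if P a then μ a else 0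

/-- `μ` is the uniform distribution on the set `S`. -/
def IsUniformOn {α : Type*} (μ : PMF α) (S : Set α) : Prop :=
  ∀ a, μ a = if a ∈ S then (S.ncard : ℝ≥0∞)⁻¹ else 0

/-- `P` lists the `k+1` vertices of a `(G₁,G₂)`-alternating path of length `k`: the vertices
are distinct and consecutive vertices are joined by an edge of `G₁` (for steps of even index)
or of `G₂` (for steps of odd index). -/
def IsAltSeq (G₁ G₂ : SimpleGraph (Fin n)) (k : ℕ) (P : Fin (k + 1) → Fin n) : Prop :=
  Function.Injective P ∧
    ∀ i : Fin k, if (i : ℕ) % 2 = 0 then G₁.Adj (P i.castSucc) (P i.succ)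
      else G₂.Adj (P i.castSucc) (P i.succ)

/-- The number of `(G₁,G₂)`-alternating `x,y`-paths of length `k` with no internal vertex
in `Z`. -/
def altPathCount (G₁ G₂ : SimpleGraph (Fin n)) (k : ℕ) (x y : Fin n) (Z : Set (Fin n)) : ℕ :=
  Nat.card {P : Fin (k + 1) → Fin n // IsAltSeq G₁ G₂ k P ∧ P 0 = x ∧ P (Fin.last k) = y ∧
    ∀ i : Fin (k + 1), i ≠ 0 → i ≠ Fin.last k → P i ∉ Z}

/-- The number of `(G₁,G₂)`-alternating paths of length `k` starting at `x`. -/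
def altStartCount (G₁ G₂ : SimpleGraph (Fin n)) (k : ℕ) (x : Fin n) : ℕ :=
  Nat.card {P : Fin (k + 1) → Fin n // IsAltSeq G₁ G₂ k P ∧ P 0 = x}

/-- The external neighbourhood `N_G(U)` of a set of vertices `U`. -/
def nbhd (G : SimpleGraph (Fin n)) (U : Set (Fin n)) : Set (Fin n) :=
  {v | v ∉ U ∧ ∃ u ∈ U, G.Adj u v}

/-- `e_G(U)`, the number of edges of `G` with both endpoints in `U`. -/
def edgesWithin (G : SimpleGraph (Fin n)) (U : Set (Fin n)) : ℕ :=
  {e ∈ G.edgeSet | ∀ v ∈ e, v ∈ U}.ncard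

/-- `e_G(U,V) = |{(u,v) : u ∈ U, v ∈ V, uv ∈ E(G)}|`. -/
def edgesBetween (G : SimpleGraph (Fin n)) (U V : Set (Fin n)) : ℕ :=
  {p : Fin n × Fin n | p.1 ∈ U ∧ p.2 ∈ V ∧ G.Adj p.1 p.2}.ncard

/-- `|E_{≥2,G}(U)|`, the number of edges `xy ∈ E(G)` with `x ∈ U`, `y ∉ U` such that some
`x' ∈ U ∖ {x}` also satisfies `x'y ∈ E(G)`. -/
def E2count (G : SimpleGraph (Fin n)) (U : Set (Fin n)) : ℕ :=
  {e : Sym2 (Fin n) | e ∈ G.edgeSet ∧ ∃ x y, e = s(x, y) ∧ x ∈ U ∧ y ∉ U ∧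
    ∃ x' ∈ U, x' ≠ x ∧ G.Adj x' y}.ncard

/-- `Σ_{u ∈ N_{F∖K}(v)} Σ_{u' ∈ N_K(u)} d_{F∖K}(u')`. -/
def doubleDegSum (F K : SimpleGraph (Fin n)) (v : Fin n) : ℝ :=
  ∑ u : Fin n, if (F \ K).Adj v u then
    ∑ u' : Fin n, if K.Adj u u' then (deg (F \ K) u' : ℝ) else 0
  else 0

/-- `μ` is the law of the binomial random graph `G(n,p)`. -/
def IsGnp (μ : PMF (SimpleGraph (Fin n))) (p : ℝ) : Prop :=
  ∀ G, μ G = ENNReal.ofReal (p ^ edgeCount G * (1 - p) ^ (n.choose 2 - edgeCount G))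

/-- `μ` is the law of `G(n,p)`, where `p` is truncated to `[0,1]` (so that `G(n,p)` is the
empty graph for `p ≤ 0` and the complete graph for `p ≥ 1`). -/
def IsGnpLaw (μ : PMF (SimpleGraph (Fin n))) (p : ℝ) : Prop :=
  IsGnp μ (max 0 (min p 1))

/-- `μ` is the law of `K + E`, where `E` includes each pair not in `E(K)` independently with
probability `p`. -/
def IsAddGnp (μ : PMF (SimpleGraph (Fin n))) (K : SimpleGraph (Fin n)) (p : ℝ) : Prop :=
  ∀ F, μ F = if K ≤ F then
      ENNReal.ofReal (p ^ (edgeCount F - edgeCount K) * (1 - p) ^ (n.choose 2 - edgeCount F))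
    else 0

/-- `ν` is the joint law of `(K, F)` where `K ~ G_d(n)` is a uniformly random `d`-regular graph
and `F = K + E`, `E` including each pair not in `E(K)` independently with probability `p`. -/
def IsRegAddGnp (ν : PMF (SimpleGraph (Fin n) × SimpleGraph (Fin n))) (d : ℕ) (p : ℝ) : Prop :=
  ∀ w, ν w = if IsRegularGraph w.1 d ∧ w.1 ≤ w.2 then
      ({G : SimpleGraph (Fin n) | IsRegularGraph G d}.ncard : ℝ≥0∞)⁻¹ *
        ENNReal.ofReal (p ^ (edgeCount w.2 - edgeCount w.1) *
          (1 - p) ^ (n.choose 2 - edgeCount w.2))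
    else 0

/-- `ν` is the joint law of an independent pair `(K, F)` with `K ~ G_d(n)` and `F ~ G(n,q)`. -/
def IsRegIndepGnp (ν : PMF (SimpleGraph (Fin n) × SimpleGraph (Fin n))) (d : ℕ) (q : ℝ) :
    Prop :=
  ∀ w, ν w = (if IsRegularGraph w.1 d then
      ({G : SimpleGraph (Fin n) | IsRegularGraph G d}.ncard : ℝ≥0∞)⁻¹ else 0) *
      ENNReal.ofReal (q ^ edgeCount w.2 * (1 - q) ^ (n.choose 2 - edgeCount w.2))


/-- The probability that adding random edges to `K` yields `F`. -/
def addWeight (p : ℝ) (K F : SimpleGraph (Fin n)) : ℝ :=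
  p ^ (edgeCount F - edgeCount K) * (1 - p) ^ (n.choose 2 - edgeCount F)

lemma addWeight_nonneg {p : ℝ} (h0 : 0 ≤ p) (h1 : p ≤ 1) (K F : SimpleGraph (Fin n)) :
    0 ≤ addWeight p K F :=
  mul_nonneg (pow_nonneg h0 _) (pow_nonneg (sub_nonneg.2 h1) _)

lemma edgeCount_eq_card_edgeFinset (G : SimpleGraph (Fin n)) :
    edgeCount G = G.edgeFinset.card := by
  rw [edgeCount, ← SimpleGraph.coe_edgeFinset, Set.ncard_coe_finset]

/-- The unordered pairs with one end in `U` and the other in `V`. -/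
def crossPairs (U V : Finset (Fin n)) : Finset (Sym2 (Fin n)) :=
  (U ×ˢ V).image fun x => s(x.1, x.2)

lemma edgesBetween_eq_card_filter (G : SimpleGraph (Fin n)) [DecidableRel G.Adj]
    (U V : Finset (Fin n)) :
    edgesBetween G U V = ((U ×ˢ V).filter fun x => G.Adj x.1 x.2).card := by
  rw [edgesBetween, ← Set.ncard_coe_finset]
  congr 1
  ext x
  simp [and_assoc]

lemma edgesBetween_eq_card_inter (G : SimpleGraph (Fin n)) [Fintype G.edgeSet]
    {U V : Finset (Fin n)}
    (h : Disjoint U V) :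
    edgesBetween G U V = (G.edgeFinset ∩ crossPairs U V).card := by
  rw [edgesBetween_eq_card_filter]
  have himage : G.edgeFinset ∩ crossPairs U V =
      ((U ×ˢ V).filter fun x => G.Adj x.1 x.2).image fun x => s(x.1, x.2) := by
    ext e
    simp only [crossPairs, Finset.mem_inter, Finset.mem_image, Finset.mem_filter,
      SimpleGraph.mem_edgeFinset]
    constructor
    · rintro ⟨he, x, hx, rfl⟩
      exact ⟨x, ⟨hx, he⟩, rfl⟩
    · rintro ⟨x, ⟨hx, he⟩, rfl⟩
      exact ⟨he, x, hx, rfl⟩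
  rw [himage, Finset.card_image_of_injOn]
  rintro ⟨a, b⟩ hab ⟨a', b'⟩ hab' heq
  simp only [Finset.coe_filter, Finset.mem_product, Set.mem_ofPred_eq] at hab hab'
  rcases Sym2.eq_iff.1 heq with ⟨h1, h2⟩ | ⟨h1, h2⟩
  · simp_all
  · obtain rfl : a = b' := h1
    exact absurd hab.1.1 (Finset.disjoint_right.1 h hab'.1.2)

lemma edgesBetween_compl_add (K : SimpleGraph (Fin n)) {U V : Finset (Fin n)}
    (h : Disjoint U V) :
    edgesBetween K U V + edgesBetween Kᶜ U V = U.card * V.card := by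
  rw [edgesBetween_eq_card_filter, edgesBetween_eq_card_filter, ← Finset.card_product,
    ← Finset.card_filter_add_card_filter_not (s := U ×ˢ V) (fun x => K.Adj x.1 x.2)]
  congr 2
  refine Finset.filter_congr fun x hx => ?_
  rw [Finset.mem_product] at hx
  rw [SimpleGraph.compl_adj]
  have : x.1 ≠ x.2 := fun hne => Finset.disjoint_left.1 h hx.1 (hne ▸ hx.2)
  tauto

lemma edgesBetween_le_of_regular {K : SimpleGraph (Fin n)} {d : ℕ} (hK : IsRegularGraph K d)
    (U V : Finset (Fin n)) : edgesBetween K U V ≤ U.card * d := by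
  rw [edgesBetween_eq_card_filter, Finset.card_filter, Finset.sum_product,
    ← smul_eq_mul, ← Finset.sum_const]
  refine Finset.sum_le_sum fun u _ => ?_
  rw [← Finset.card_filter, ← hK u, deg, Nat.card_coe_set_eq, ← Set.ncard_coe_finset]
  refine Set.ncard_le_ncard ?_ (Set.toFinite _)
  intro v hv
  simp only [Finset.coe_filter, Set.mem_ofPred_eq] at hv
  exact hv.2

/-- Chernoff-type bound on the exponential moment of the number of added edges. -/
lemma sum_addWeight_mul_exp_le {p : ℝ} (h0 : 0 ≤ p) (h1 : p ≤ 1) (K : SimpleGraph (Fin n))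
    {U V : Finset (Fin n)} (h : Disjoint U V) (s : ℝ) :
    ∑ F with K ≤ F, addWeight p K F * Real.exp (s * edgesBetween (F \ K) U V) ≤
      Real.exp (p * (Real.exp s - 1) * edgesBetween Kᶜ U V) := by
  set S := crossPairs U V with hS
  set A := (Kᶜ).edgeFinset with hA
  let f : Sym2 (Fin n) → ℝ := fun e => p * if e ∈ S then Real.exp s else 1
  have hf0 : ∀ e, 0 ≤ f e := fun e => mul_nonneg h0 (by split_ifs <;> positivity)
  have hprod_f : ∀ t : Finset (Sym2 (Fin n)),
      ∏ e ∈ t, f e = p ^ t.card * Real.exp (s * (t ∩ S).card) := by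
    intro t
    rw [Finset.prod_mul_distrib, Finset.prod_const, Finset.prod_ite_mem, Finset.prod_const,
      mul_comm s, Real.exp_nat_mul]
  have hAcard : A.card + edgeCount K = n.choose 2 := by
    have : A = (⊤ : SimpleGraph (Fin n)).edgeFinset \ K.edgeFinset := by
      ext e
      simp only [hA, ← SimpleGraph.edgeFinset_sdiff, SimpleGraph.mem_edgeFinset, top_sdiff]
    have hle : K.edgeFinset ⊆ (⊤ : SimpleGraph (Fin n)).edgeFinset :=
      SimpleGraph.edgeFinset_mono le_top
    rw [this, edgeCount_eq_card_edgeFinset, Finset.card_sdiff_add_card_eq_card hle,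
      SimpleGraph.card_edgeFinset_top_eq_card_choose_two, Fintype.card_fin]
  have hterm : ∀ F : SimpleGraph (Fin n), K ≤ F →
      addWeight p K F * Real.exp (s * edgesBetween (F \ K) U V) =
        (∏ e ∈ (F \ K).edgeFinset, f e) * ∏ _e ∈ A \ (F \ K).edgeFinset, (1 - p) := by
    intro F hKF
    have hsub : (F \ K).edgeFinset ⊆ A := by
      refine SimpleGraph.edgeFinset_mono ?_
      rw [← top_sdiff]
      exact sdiff_le_sdiff_right le_top
    have hc : (F \ K).edgeFinset.card + edgeCount K = edgeCount F := by
      rw [SimpleGraph.edgeFinset_sdiff, edgeCount_eq_card_edgeFinset, edgeCount_eq_card_edgeFinset,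
        Finset.card_sdiff_add_card_eq_card (SimpleGraph.edgeFinset_mono hKF)]
    have hle := Finset.card_le_card hsub
    rw [hprod_f, Finset.prod_const, Finset.card_sdiff_of_subset hsub, addWeight,
      edgesBetween_eq_card_inter _ h,
      show edgeCount F - edgeCount K = (F \ K).edgeFinset.card by omega,
      show n.choose 2 - edgeCount F = A.card - (F \ K).edgeFinset.card by omega, ← hS]
    ring
  calc ∑ F with K ≤ F, addWeight p K F * Real.exp (s * edgesBetween (F \ K) U V)
      = ∑ F with K ≤ F,
          (∏ e ∈ (F \ K).edgeFinset, f e) * ∏ _e ∈ A \ (F \ K).edgeFinset, (1 - p) :=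
        Finset.sum_congr rfl fun F hF => hterm F (Finset.mem_filter.1 hF).2
    _ = ∑ t ∈ (Finset.univ.filter fun F => K ≤ F).image fun F => (F \ K).edgeFinset,
          (∏ e ∈ t, f e) * ∏ _e ∈ A \ t, (1 - p) := by
        rw [Finset.sum_image]
        intro F hF F' hF' heq
        simp only [Finset.coe_filter, Finset.mem_univ, true_and, Set.mem_ofPred_eq] at hF hF'
        rw [← sup_sdiff_cancel_right hF, ← sup_sdiff_cancel_right hF',
          SimpleGraph.edgeFinset_inj.1 heq]
    _ ≤ ∑ t ∈ A.powerset, (∏ e ∈ t, f e) * ∏ _e ∈ A \ t, (1 - p) := by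
        refine Finset.sum_le_sum_of_subset_of_nonneg ?_ fun t _ _ =>
          mul_nonneg (Finset.prod_nonneg fun e _ => hf0 e)
            (Finset.prod_nonneg fun _ _ => sub_nonneg.2 h1)
        intro t ht
        obtain ⟨F, -, rfl⟩ := Finset.mem_image.1 ht
        refine Finset.mem_powerset.2 (SimpleGraph.edgeFinset_mono ?_)
        rw [← top_sdiff]
        exact sdiff_le_sdiff_right le_top
    _ = ∏ e ∈ A, (f e + (1 - p)) := (Finset.prod_add f (fun _ => 1 - p) A).symm
    _ ≤ ∏ e ∈ A, Real.exp (if e ∈ S then p * (Real.exp s - 1) else 0) := by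
        refine Finset.prod_le_prod (fun e _ => add_nonneg (hf0 e) (sub_nonneg.2 h1)) fun e _ => ?_
        refine le_trans (le_of_eq ?_) (Real.add_one_le_exp _)
        simp only [f]
        split_ifs <;> ring
    _ = Real.exp (p * (Real.exp s - 1) * edgesBetween Kᶜ U V) := by
        rw [← Real.exp_sum, Finset.sum_ite_mem, Finset.sum_const, nsmul_eq_mul,
          edgesBetween_eq_card_inter _ h, mul_comm]

/-- The number of added edges between `U` and `V` deviates from `p|U||V|` by more than
a factor `1 ± 3 lam`. -/
def IsBadPair (lam p : ℝ) (K : SimpleGraph (Fin n)) (U V : Finset (Fin n))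
    (F : SimpleGraph (Fin n)) : Prop :=
  ¬ ((1 - 3 * lam) * p * U.card * V.card ≤ (edgesBetween (F \ K) U V : ℝ) ∧
    (edgesBetween (F \ K) U V : ℝ) ≤ (1 + 3 * lam) * p * U.card * V.card)

lemma sum_addWeight_bad_le {p lam : ℝ} (h0 : 0 ≤ p) (h1 : p ≤ 1) (hl0 : 0 ≤ lam) (hl1 : lam ≤ 1)
    (K : SimpleGraph (Fin n)) {U V : Finset (Fin n)} (h : Disjoint U V)
    (hK : (edgesBetween K U V : ℝ) ≤ lam * (U.card * V.card)) :
    ∑ F with K ≤ F ∧ IsBadPair lam p K U V F, addWeight p K F ≤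
      2 * Real.exp (-(lam ^ 2 * (p * U.card * V.card))) := by
  set M : ℝ := p * U.card * V.card with hM
  have hM0 : 0 ≤ M := by positivity
  set N : ℝ := ((edgesBetween Kᶜ U V : ℕ) : ℝ)
  have hN : (edgesBetween K U V : ℝ) + N = U.card * V.card :=
by
    simpa using congrArg (Nat.cast (R := ℝ)) (edgesBetween_compl_add K h)
  have hNup : p * N ≤ M := by
    rw [hM, mul_assoc]
    exact mul_le_mul_of_nonneg_left (by linarith [Nat.cast_nonneg (α := ℝ) (edgesBetween K U V)]) h0
  have hNlow : (1 - lam) * M ≤ p * N := by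
    have : (1 - lam) * M = p * ((1 - lam) * (U.card * V.card)) := by rw [hM]; ring
    rw [this]
    exact mul_le_mul_of_nonneg_left (by linarith) h0
  have hexp : ∀ F : SimpleGraph (Fin n), K ≤ F ∧ IsBadPair lam p K U V F →
      addWeight p K F ≤
        addWeight p K F * Real.exp (lam * edgesBetween (F \ K) U V) *
            Real.exp (-(lam * ((1 + 3 * lam) * M))) +
          addWeight p K F * Real.exp (-lam * edgesBetween (F \ K) U V) *
            Real.exp (lam * ((1 - 3 * lam) * M)) := by
    rintro F ⟨-, hF⟩
    have hw := addWeight_nonneg h0 h1 K F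
    rw [mul_assoc, mul_assoc, ← Real.exp_add, ← Real.exp_add, ← mul_add]
    refine le_mul_of_one_le_right hw ?_
    rw [IsBadPair, not_and_or, not_le, not_le, mul_assoc, mul_assoc, mul_assoc, mul_assoc,
      ← mul_assoc p, ← hM] at hF
    rcases hF with hF | hF
    · have := mul_le_mul_of_nonneg_left hF.le hl0
      exact le_add_of_nonneg_of_le (Real.exp_pos _).le (Real.one_le_exp (by linarith))
    · have := mul_le_mul_of_nonneg_left hF.le hl0
      exact le_add_of_le_of_nonneg (Real.one_le_exp (by linarith)) (Real.exp_pos _).le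
  have hup := abs_le.1 (Real.abs_exp_sub_one_sub_id_le (x := lam) (abs_le.2 ⟨by linarith, hl1⟩))
  have hlow := abs_le.1 (Real.abs_exp_sub_one_sub_id_le (x := -lam)
    (abs_le.2 ⟨by linarith, by linarith⟩))
  calc ∑ F with K ≤ F ∧ IsBadPair lam p K U V F, addWeight p K F
      ≤ ∑ F with K ≤ F ∧ IsBadPair lam p K U V F,
          (addWeight p K F * Real.exp (lam * edgesBetween (F \ K) U V) *
            Real.exp (-(lam * ((1 + 3 * lam) * M))) +
          addWeight p K F * Real.exp (-lam * edgesBetween (F \ K) U V) *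
            Real.exp (lam * ((1 - 3 * lam) * M))) :=
        Finset.sum_le_sum fun F hF => hexp F (Finset.mem_filter.1 hF).2
    _ ≤ ∑ F with K ≤ F,
          (addWeight p K F * Real.exp (lam * edgesBetween (F \ K) U V) *
            Real.exp (-(lam * ((1 + 3 * lam) * M))) +
          addWeight p K F * Real.exp (-lam * edgesBetween (F \ K) U V) *
            Real.exp (lam * ((1 - 3 * lam) * M))) := by
        refine Finset.sum_le_sum_of_subset_of_nonneg ?_ fun F _ _ => ?_
        · exact Finset.monotone_filter_right _ fun F _ hF => hF.1
        · have hw := addWeight_nonneg h0 h1 K F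
          positivity
    _ ≤ Real.exp (p * (Real.exp lam - 1) * N) * Real.exp (-(lam * ((1 + 3 * lam) * M))) +
          Real.exp (p * (Real.exp (-lam) - 1) * N) * Real.exp (lam * ((1 - 3 * lam) * M)) := by
        rw [Finset.sum_add_distrib, ← Finset.sum_mul, ← Finset.sum_mul]
        gcongr
        · exact sum_addWeight_mul_exp_le h0 h1 K h lam
        · exact sum_addWeight_mul_exp_le h0 h1 K h (-lam)
    _ ≤ 2 * Real.exp (-(lam ^ 2 * M)) := by
        rw [← Real.exp_add, ← Real.exp_add, two_mul]
        have hl2 : 0 ≤ lam ^ 2 * M := by positivity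
        have hpN : 0 ≤ p * N := by positivity
        gcongr
        · have h3 : (Real.exp lam - 1) * (p * N) ≤ (lam + lam ^ 2) * M :=
            mul_le_mul (by linarith) hNup hpN (by positivity)
          nlinarith
        · have h3 : (Real.exp (-lam) - 1) * (p * N) ≤ (-lam + lam ^ 2) * (p * N) :=
            mul_le_mul_of_nonneg_right (by nlinarith) hpN
          have h4 : (lam - lam ^ 2) * ((1 - lam) * M) ≤ (lam - lam ^ 2) * (p * N) :=
            mul_le_mul_of_nonneg_left hNlow (by nlinarith)
          have h5 : 0 ≤ lam ^ 3 * M := by positivity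
          nlinarith

lemma sum_one_div_pow_card_le (hn : 0 < n) :
    ∑ U : Finset (Fin n), (1 / (n : ℝ)) ^ U.card ≤ 3 := by
  have hn' : (n : ℝ) ≠ 0 := by positivity
  have h := Fintype.sum_pow_mul_eq_add_pow (Fin n) (1 / (n : ℝ)) 1
  simp only [one_pow, mul_one, Fintype.card_fin] at h
  calc ∑ U : Finset (Fin n), (1 / (n : ℝ)) ^ U.card = (1 / (n : ℝ) + 1) ^ n := h
    _ ≤ Real.exp (1 / (n : ℝ)) ^ n :=
        pow_le_pow_left₀ (by positivity) (Real.add_one_le_exp _) n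
    _ = Real.exp 1 := by rw [← Real.exp_nat_mul, mul_one_div_cancel hn']
    _ ≤ 3 := Real.exp_one_lt_three.le

lemma exp_neg_log_mul_card_le (hn : 0 < n) {U : Finset (Fin n)} (hU : U.Nonempty) :
    Real.exp (-(10 * Real.log n * U.card)) ≤ (1 / (n : ℝ)) ^ 9 * (1 / (n : ℝ)) ^ U.card := by
  have hn' : (0 : ℝ) < n := by positivity
  have hc : 1 ≤ U.card := hU.card_pos
  have hlog : Real.exp (-Real.log n) = 1 / (n : ℝ) := by
    rw [Real.exp_neg, Real.exp_log hn', one_div]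
  rw [show -(10 * Real.log n * U.card) = ((10 * U.card : ℕ) : ℝ) * -Real.log n by push_cast; ring,
    Real.exp_nat_mul, hlog, ← pow_add]
  refine pow_le_pow_of_le_one (by positivity) ?_ (by omega)
  rw [div_le_one hn']
  exact_mod_cast hn

lemma sum_biUnion_le_of_nonneg {ι α : Type*} (s : Finset ι) (t : ι → Finset α) {f : α → ℝ}
    (hf : ∀ a, 0 ≤ f a) : ∑ a ∈ s.biUnion t, f a ≤ ∑ i ∈ s, ∑ a ∈ t i, f a := by
  induction s using Finset.induction_on with
  | empty => simp
  | insert i s hi ih =>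
    rw [Finset.biUnion_insert, Finset.sum_insert hi]
    have h := Finset.sum_union_inter (s₁ := t i) (s₂ := s.biUnion t) (f := f)
    have h' : 0 ≤ ∑ a ∈ t i ∩ s.biUnion t, f a := Finset.sum_nonneg fun a _ => hf a
    linarith

/-- Union bound over the pairs of sets satisfying `Q`. -/
lemma sum_addWeight_exists_bad_le {p lam : ℝ} (hn : 0 < n) (h0 : 0 ≤ p) (h1 : p ≤ 1)
    (hl0 : 0 ≤ lam) (hl1 : lam ≤ 1) (K : SimpleGraph (Fin n))
    (Q : Finset (Fin n) → Finset (Fin n) → Prop)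
    (hQ : ∀ U V, Q U V → Disjoint U V ∧ U.Nonempty ∧ V.Nonempty ∧
      (edgesBetween K U V : ℝ) ≤ lam * (U.card * V.card) ∧
      10 * Real.log n * U.card + 10 * Real.log n * V.card ≤
        lam ^ 2 * (p * U.card * V.card))
    (P : SimpleGraph (Fin n) → Prop) (hP : ∀ F, ¬ P F → ∃ U V, Q U V ∧ IsBadPair lam p K U V F) :
    ∑ F with K ≤ F ∧ ¬ P F, addWeight p K F ≤
      18 / (n : ℝ) ^ 18 := by
  have hpair : ∀ U V, Q U V →
      ∑ F with K ≤ F ∧ IsBadPair lam p K U V F, addWeight p K F ≤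
        2 * (1 / (n : ℝ)) ^ 18 * ((1 / (n : ℝ)) ^ U.card * (1 / (n : ℝ)) ^ V.card) := by
    intro U V hUV
    obtain ⟨hd, hU, hV, hK, hM⟩ := hQ U V hUV
    calc ∑ F with K ≤ F ∧ IsBadPair lam p K U V F, addWeight p K F
        ≤ 2 * Real.exp (-(lam ^ 2 * (p * U.card * V.card))) :=
          sum_addWeight_bad_le h0 h1 hl0 hl1 K hd hK
      _ ≤ 2 * (Real.exp (-(10 * Real.log n * U.card)) * Real.exp (-(10 * Real.log n * V.card))) := by
          rw [← Real.exp_add]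
          gcongr
          linarith
      _ ≤ 2 * (((1 / (n : ℝ)) ^ 9 * (1 / (n : ℝ)) ^ U.card) *
            ((1 / (n : ℝ)) ^ 9 * (1 / (n : ℝ)) ^ V.card)) := by
          gcongr
          · exact exp_neg_log_mul_card_le hn hU
          · exact exp_neg_log_mul_card_le hn hV
      _ = _ := by ring
  calc ∑ F with K ≤ F ∧ ¬ P F, addWeight p K F
      ≤ ∑ F ∈ (Finset.univ.filter fun x : Finset (Fin n) × Finset (Fin n) => Q x.1 x.2).biUnion
          (fun x => Finset.univ.filter fun F => K ≤ F ∧ IsBadPair lam p K x.1 x.2 F),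
          addWeight p K F := by
        refine Finset.sum_le_sum_of_subset_of_nonneg ?_ fun F _ _ => addWeight_nonneg h0 h1 K F
        intro F hF
        obtain ⟨-, hKF, hPF⟩ := Finset.mem_filter.1 hF
        obtain ⟨U, V, hUV, hb⟩ := hP F hPF
        exact Finset.mem_biUnion.2 ⟨(U, V), by simpa using hUV, by simp [hKF, hb]⟩
    _ ≤ ∑ x : Finset (Fin n) × Finset (Fin n) with Q x.1 x.2,
          ∑ F with K ≤ F ∧ IsBadPair lam p K x.1 x.2 F, addWeight p K F :=
        sum_biUnion_le_of_nonneg _ _ (addWeight_nonneg h0 h1 K)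
    _ ≤ ∑ x : Finset (Fin n) × Finset (Fin n) with Q x.1 x.2,
          2 * (1 / (n : ℝ)) ^ 18 * ((1 / (n : ℝ)) ^ x.1.card * (1 / (n : ℝ)) ^ x.2.card) :=
        Finset.sum_le_sum fun x hx => hpair x.1 x.2 (Finset.mem_filter.1 hx).2
    _ ≤ ∑ x : Finset (Fin n) × Finset (Fin n),
          2 * (1 / (n : ℝ)) ^ 18 * ((1 / (n : ℝ)) ^ x.1.card * (1 / (n : ℝ)) ^ x.2.card) :=
        Finset.sum_le_sum_of_subset_of_nonneg (Finset.filter_subset _ _) fun x _ _ => by positivity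
    _ = 2 * (1 / (n : ℝ)) ^ 18 * ((∑ U : Finset (Fin n), (1 / (n : ℝ)) ^ U.card) *
          ∑ V : Finset (Fin n), (1 / (n : ℝ)) ^ V.card) := by
        rw [← Finset.mul_sum, Fintype.sum_prod_type, Finset.sum_mul_sum]
    _ ≤ 2 * (1 / (n : ℝ)) ^ 18 * (3 * 3) := by
        gcongr
        · exact sum_one_div_pow_card_le hn
        · exact sum_one_div_pow_card_le hn
    _ = 18 / (n : ℝ) ^ 18 := by
        rw [div_pow, one_pow]
        ring

lemma le_prEvent_of_forall_sum_le {d : ℕ} {p R : ℝ} (h0 : 0 ≤ p) (h1 : p ≤ 1) (hR : 0 ≤ R)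
    {ν : PMF (SimpleGraph (Fin n) × SimpleGraph (Fin n))} (hν : IsRegAddGnp ν d p)
    (P : SimpleGraph (Fin n) → SimpleGraph (Fin n) → Prop)
    (hP : ∀ K, IsRegularGraph K d → ∑ F with K ≤ F ∧ ¬ P K F, addWeight p K F ≤ R) :
    ENNReal.ofReal (1 - R) ≤ prEvent ν (fun w => P w.1 w.2) := by
  rw [ENNReal.ofReal_sub _ hR, ENNReal.ofReal_one, tsub_le_iff_right]
  have hsplit : (1 : ℝ≥0∞) = prEvent ν (fun w => P w.1 w.2) +
      ∑ w, if P w.1 w.2 then 0 else ν w := by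
    rw [← ν.tsum_coe, prEvent, tsum_fintype, tsum_fintype, ← Finset.sum_add_distrib]
    refine Finset.sum_congr rfl fun w _ => ?_
    split_ifs <;> simp
  rw [hsplit]
  gcongr
  set S := {G : SimpleGraph (Fin n) | IsRegularGraph G d}
  have hinner : ∀ K, (∑ F, if P K F then 0 else ν (K, F)) ≤
      if K ∈ S then (S.ncard : ℝ≥0∞)⁻¹ * ENNReal.ofReal R else 0 := by
    intro K
    split_ifs with hK
    · calc (∑ F, if P K F then 0 else ν (K, F))
          = (S.ncard : ℝ≥0∞)⁻¹ *
              ∑ F with K ≤ F ∧ ¬ P K F, ENNReal.ofReal (addWeight p K F) := by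
            rw [Finset.mul_sum, Finset.sum_filter]
            refine Finset.sum_congr rfl fun F _ => ?_
            rw [hν (K, F)]
            have hK' : IsRegularGraph K d := hK
            by_cases h : P K F <;> by_cases h' : K ≤ F <;> simp [h, h', hK', addWeight, S]
        _ ≤ _ := by
            gcongr
            rw [← ENNReal.ofReal_sum_of_nonneg fun F _ => addWeight_nonneg h0 h1 K F]
            exact ENNReal.ofReal_le_ofReal (hP K hK)
    · refine le_of_eq (Finset.sum_eq_zero fun F _ => ?_)
      have hK' : ¬ IsRegularGraph K d := hK
      rw [hν (K, F)]
      simp [hK']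
  calc ∑ w, (if P w.1 w.2 then 0 else ν w)
      = ∑ K, ∑ F, if P K F then 0 else ν (K, F) := Fintype.sum_prod_type _
    _ ≤ ∑ K, if K ∈ S then (S.ncard : ℝ≥0∞)⁻¹ * ENNReal.ofReal R else 0 :=
        Finset.sum_le_sum fun K _ => hinner K
    _ = (S.ncard : ℝ≥0∞) * (S.ncard : ℝ≥0∞)⁻¹ * ENNReal.ofReal R := by
        rw [← Finset.sum_filter, Finset.sum_const, nsmul_eq_mul, mul_assoc,
          ← Set.ncard_coe_finset]
        simp
    _ ≤ 1 * ENNReal.ofReal R := by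
        gcongr
        exact ENNReal.mul_inv_le_one _
    _ = ENNReal.ofReal R := one_mul _

lemma eventually_rpow_mul_log_pow_le {ε : ℝ} (hε : 0 < ε) :
    ∀ᶠ n : ℕ in Filter.atTop, (n : ℝ) ^ (1 / 10 : ℝ) * Real.log n ^ 6 ≤ ε * n := by
  have h := (isLittleO_log_rpow_rpow_atTop (s := 9 / 10) 6 (by norm_num)).bound hε
  filter_upwards [tendsto_natCast_atTop_atTop.eventually h, Filter.eventually_ge_atTop 1]
    with n hn hn1
  have hn0 : (0 : ℝ) < n := by positivity
  have hlog : 0 ≤ Real.log n := Real.log_natCast_nonneg n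
  rw [Real.norm_of_nonneg (by positivity), Real.norm_of_nonneg (by positivity),
    show (6 : ℝ) = ((6 : ℕ) : ℝ) by norm_num, Real.rpow_natCast] at hn
  calc (n : ℝ) ^ (1 / 10 : ℝ) * Real.log n ^ 6
      ≤ (n : ℝ) ^ (1 / 10 : ℝ) * (ε * (n : ℝ) ^ (9 / 10 : ℝ)) := by gcongr
    _ = ε * ((n : ℝ) ^ (1 / 10 : ℝ) * (n : ℝ) ^ (9 / 10 : ℝ)) := by ring
    _ = ε * n := by rw [← Real.rpow_add hn0]; norm_num

/-- The parameter estimates on which the union bound relies. -/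
lemma parameter_bounds {ε σ lam μ p : ℝ} {n d m : ℕ} (hε : 0 < ε) (hε1 : ε ≤ 1) (hσ : σ ≤ 1 / 10)
    (hn2 : (2 : ℝ) ≤ n) (hL : 2 ≤ Real.log n)
    (hlogn : (n : ℝ) ^ (1 / 10 : ℝ) * Real.log n ^ 6 ≤ ε * n)
    (hlam : (Real.log n ^ 3)⁻¹ ≤ lam) (hlam1 : lam ≤ 1 / 10)
    (hμ : (Real.log n ^ 3)⁻¹ ≤ μ) (hμ1 : μ ≤ 1 / 10)
    (hdm : ε * d * n ≤ (m : ℝ)) (hm : (m : ℝ) ≤ (n : ℝ) ^ ((1 : ℝ) + σ))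
    (hC : 20 * Real.log n ≤ lam ^ 2 * μ * (2 * (m : ℝ) / n))
    (hp : p = (m : ℝ) / ((n.choose 2 : ℝ) - d * n / 2)) :
    0 < lam ∧ 0 < μ ∧ 0 ≤ p ∧ p ≤ 1 ∧ (d : ℝ) ≤ lam * μ * n ∧
      20 * Real.log n ≤ lam ^ 2 * p * (μ * n) := by
  set L := Real.log n
  have hn0 : (0 : ℝ) < n := by linarith
  have hinv : (0 : ℝ) < (L ^ 3)⁻¹ := by positivity
  have hlam0 : 0 < lam := hinv.trans_le hlam
  have hμ0 : 0 < μ := hinv.trans_le hμ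
  have hmn : (m : ℝ) ≤ n * (n : ℝ) ^ (1 / 10 : ℝ) := by
    refine hm.trans ?_
    rw [Real.rpow_add hn0, Real.rpow_one]
    gcongr
    linarith
  have hd : (d : ℝ) ≤ lam * μ * n := by
    have h1 : ε * d ≤ (n : ℝ) ^ (1 / 10 : ℝ) :=
      le_of_mul_le_mul_right (by linarith) hn0
    have h2 : ε * (d * L ^ 6) ≤ ε * n := by
      calc ε * (d * L ^ 6) = ε * d * L ^ 6 := by ring
        _ ≤ (n : ℝ) ^ (1 / 10 : ℝ) * L ^ 6 := by gcongr
        _ ≤ ε * n := hlogn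
    have h3 : (d : ℝ) * L ^ 6 ≤ n := le_of_mul_le_mul_left h2 hε
    calc (d : ℝ) = (L ^ 3)⁻¹ * (L ^ 3)⁻¹ * (d * L ^ 6) := by field_simp
      _ ≤ lam * μ * n := by gcongr
  have hsmall : (n : ℝ) ^ (1 / 10 : ℝ) ≤ n / 10 := by
    have h64 : (64 : ℝ) ≤ L ^ 6 := by
      calc (64 : ℝ) = 2 ^ 6 := by norm_num
        _ ≤ L ^ 6 := by gcongr
    have hr : 0 ≤ (n : ℝ) ^ (1 / 10 : ℝ) := by positivity
    have h1 := mul_le_mul_of_nonneg_left h64 hr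
    have h2 := mul_le_mul_of_nonneg_right hε1 hn0.le
    linarith
  have hd' : (d : ℝ) ≤ n / 100 := by
    have : lam * μ ≤ 1 / 10 * (1 / 10) := by gcongr
    nlinarith
  have hchoose : (n.choose 2 : ℝ) = n * (n - 1) / 2 := Nat.cast_choose_two ℝ n
  set D : ℝ := (n.choose 2 : ℝ) - d * n / 2 with hD
  have hDlow : n * (n : ℝ) / 10 ≤ D := by rw [hD, hchoose]; nlinarith
  have hDup : D ≤ n * (n : ℝ) / 2 := by
    have : (0 : ℝ) ≤ d * n := by positivity
    rw [hD, hchoose]; nlinarith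
  have hD0 : 0 < D := lt_of_lt_of_le (by positivity) hDlow
  have hp0 : 0 ≤ p := by rw [hp]; positivity
  have hp1 : p ≤ 1 := by
    rw [hp, div_le_one hD0]
    nlinarith
  have hδp : 2 * (m : ℝ) / n ≤ p * n := by
    rw [hp, div_mul_eq_mul_div, div_le_div_iff₀ hn0 hD0]
    calc 2 * (m : ℝ) * D ≤ 2 * m * (n * n / 2) := by gcongr
      _ = m * n * n := by ring
  have hCp : 20 * L ≤ lam ^ 2 * p * (μ * n) := by
    calc 20 * L ≤ lam ^ 2 * μ * (2 * (m : ℝ) / n) := hC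
      _ ≤ lam ^ 2 * μ * (p * n) := by gcongr
      _ = lam ^ 2 * p * (μ * n) := by ring
  exact ⟨hlam0, hμ0, hp0, hp1, hd, hCp⟩

lemma eighteen_div_pow_le {c : ℝ} {n : ℕ} (hc : 0 < c) (hn2 : (2 : ℝ) ≤ n)
    (hnc : 18 / c + 2 ≤ (n : ℝ)) : (18 : ℝ) / (n : ℝ) ^ 18 ≤ c / (n : ℝ) ^ 14 := by
  have hn0 : (0 : ℝ) < n := by linarith
  have h1 : 18 ≤ c * n := by
    have := mul_le_mul_of_nonneg_left hnc hc.le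
    rw [mul_add, mul_div_cancel₀ _ hc.ne'] at this
    linarith
  have h2 : c * n ≤ c * (n : ℝ) ^ 4 := by
    gcongr
    exact le_self_pow₀ (by linarith) (by norm_num)
  rw [div_le_div_iff₀ (by positivity) (by positivity)]
  calc 18 * (n : ℝ) ^ 14 ≤ c * (n : ℝ) ^ 4 * (n : ℝ) ^ 14 := by gcongr; linarith
    _ = c * (n : ℝ) ^ 18 := by ring

/-- **Lemma 6.9.** There is `c* > 0` such that for every `ε ∈ (0,1]` and every
`σ ∈ (0,c*]` there is `C > 0` such that for every `c > 0` and all sufficiently large `n`: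
with `d ≥ C log n`, `dn` even, `(log n)⁻³ ≤ λ, μ ≤ c*`, `ε d n ≤ m ≤ n^{1+σ}`,
`δ = 2m/n` with `λ²μδ ≥ C log n`, `p = m(binom(n,2) − dn/2)⁻¹`, and `(K,F)` with
`K ~ G_d(n)`, `F = K + E`, with probability at least `1 − c n⁻¹⁴`: for all disjoint
`U, V ⊆ [n]` with `|U|, |V| ≥ μn`, `e_{F∖K}(U,V) = (1 ± 3λ)·p|U||V|`. -/
theorem connection_property :
    ∃ cstar : ℝ, 0 < cstar ∧
      ∀ ε : ℝ, 0 < ε → ε ≤ 1 →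
        ∀ σ : ℝ, 0 < σ → σ ≤ cstar →
          ∃ C : ℝ, 0 < C ∧
            ∀ c : ℝ, 0 < c →
              ∃ n₀ : ℕ, ∀ n : ℕ, n₀ ≤ n →
                ∀ lam μ : ℝ, ∀ d m : ℕ,
                  C * Real.log n ≤ (d : ℝ) → Even (d * n) →
                  ((Real.log n) ^ 3)⁻¹ ≤ lam → lam ≤ cstar →
                  ((Real.log n) ^ 3)⁻¹ ≤ μ → μ ≤ cstar →
                  ε * d * n ≤ (m : ℝ) → (m : ℝ) ≤ (n : ℝ) ^ ((1 : ℝ) + σ) →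
                  ∀ δ p : ℝ, δ = 2 * (m : ℝ) / n →
                    C * Real.log n ≤ lam ^ 2 * μ * δ →
                    p = (m : ℝ) / ((n.choose 2 : ℝ) - d * n / 2) →
                    ∀ ν : PMF (SimpleGraph (Fin n) × SimpleGraph (Fin n)),
                      IsRegAddGnp ν d p →
                      ENNReal.ofReal (1 - c / (n : ℝ) ^ 14) ≤
                        prEvent ν (fun w =>
                          ∀ U V : Set (Fin n), Disjoint U V →
                            μ * n ≤ (U.ncard : ℝ) → μ * n ≤ (V.ncard : ℝ) →
                              (1 - 3 * lam) * p * U.ncard * V.ncard ≤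
                                  (edgesBetween (w.2 \ w.1) U V : ℝ) ∧
                                (edgesBetween (w.2 \ w.1) U V : ℝ) ≤
                                  (1 + 3 * lam) * p * U.ncard * V.ncard) := by
  refine ⟨1 / 10, by norm_num, fun ε hε hε1 σ hσ hσ1 => ⟨20, by norm_num, fun c hc => ?_⟩⟩
  have hevent := ((eventually_rpow_mul_log_pow_le hε).and
    ((Real.tendsto_log_atTop.comp tendsto_natCast_atTop_atTop).eventually_ge_atTop 2)).and
    ((tendsto_natCast_atTop_atTop (R := ℝ)).eventually_ge_atTop (18 / c + 2))
  obtain ⟨n₀, hn₀⟩ := Filter.eventually_atTop.1 hevent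
  refine ⟨n₀, fun n hn lam μ d m _ _ hlam hlam1 hμ hμ1 hdm hm δ p hδ hC hp ν hν => ?_⟩
  obtain ⟨⟨hlogn, hL⟩, hnc⟩ := hn₀ n hn
  have hL : 2 ≤ Real.log n := hL
  have hn2 : (2 : ℝ) ≤ n := le_trans (by simpa using by positivity) hnc
  have hn0 : (0 : ℝ) < n := by linarith
  obtain ⟨hlam0, hμ0, hp0, hp1, hd, hCp⟩ :=
    parameter_bounds hε hε1 hσ1 hn2 hL hlogn hlam hlam1 hμ hμ1 hdm hm (hδ ▸ hC) hp
  have hnpos : 0 < n := by exact_mod_cast hn0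
  have hbound := eighteen_div_pow_le hc hn2 hnc
  refine le_trans ?_ (le_prEvent_of_forall_sum_le (R := 18 / (n : ℝ) ^ 18) hp0 hp1 (by positivity)
    hν (fun K F => ∀ U V : Set (Fin n), Disjoint U V → μ * n ≤ (U.ncard : ℝ) →
      μ * n ≤ (V.ncard : ℝ) →
        (1 - 3 * lam) * p * U.ncard * V.ncard ≤ (edgesBetween (F \ K) U V : ℝ) ∧
          (edgesBetween (F \ K) U V : ℝ) ≤ (1 + 3 * lam) * p * U.ncard * V.ncard)
    fun K hK => ?_)
  · exact ENNReal.ofReal_le_ofReal (by linarith)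
  refine sum_addWeight_exists_bad_le hnpos hp0 hp1 hlam0.le (by linarith) K
    (fun U V => Disjoint U V ∧ μ * n ≤ (U.card : ℝ) ∧ μ * n ≤ (V.card : ℝ)) ?_ _ fun F hF => ?_
  rotate_left
  · push Not at hF
    obtain ⟨U, V, hUV, hU, hV, hb⟩ := hF
    lift U to Finset (Fin n) using U.toFinite
    lift V to Finset (Fin n) using V.toFinite
    rw [Set.ncard_coe_finset] at hU hV hb
    rw [Set.ncard_coe_finset] at hb
    exact ⟨U, V, ⟨Finset.disjoint_coe.1 hUV, hU, hV⟩, fun h => (hb h.1).not_ge h.2⟩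
  · rintro U V ⟨hUV, hU, hV⟩
    have hμn : 0 < μ * n := by positivity
    have hU0 : (0 : ℝ) < U.card := hμn.trans_le hU
    have hV0 : (0 : ℝ) < V.card := hμn.trans_le hV
    refine ⟨hUV, Finset.card_pos.1 (by exact_mod_cast hU0),
      Finset.card_pos.1 (by exact_mod_cast hV0), ?_, ?_⟩
    · calc (edgesBetween K U V : ℝ) ≤ U.card * d := by
            exact_mod_cast edgesBetween_le_of_regular hK U V
        _ ≤ U.card * (lam * (μ * n)) := by
            gcongr
            linarith
        _ ≤ U.card * (lam * V.card) := by gcongr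
        _ = lam * (U.card * V.card) := by ring
    · have hu : 20 * Real.log n * U.card ≤ lam ^ 2 * (p * U.card * V.card) := by
        calc 20 * Real.log n * U.card ≤ lam ^ 2 * p * V.card * U.card :=
              mul_le_mul_of_nonneg_right (hCp.trans (by gcongr)) hU0.le
          _ = _ := by ring
      have hv : 20 * Real.log n * V.card ≤ lam ^ 2 * (p * U.card * V.card) := by
        calc 20 * Real.log n * V.card ≤ lam ^ 2 * p * U.card * V.card :=
              mul_le_mul_of_nonneg_right (hCp.trans (by gcongr)) hV0.le
          _ = _ := by ring
      linarith

end Sandwich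
end
end

section
/- There is c* > 0 such that for every ε ∈ (0,1] there is C₀ > 0 such that for every sufficiently small μ > 0 and every σ ∈ (0, c*] there is C > 0 such that for every c > 0 there is n₀ ∈ ℕ with the following property for all n ≥ n₀. Let d ∈ [n] with d ≥ C·log n and dn even, let m be an integer with ε·d·n/2 ≤ m ≤ n^{1+σ}, set δ = 2m/n, η = C₀·max{μ/log n, (n·log n/m)^{1/8}} and p = m·(binom(n,2) − dn/2)^{−1}. Let K ~ G_d(n), form E by including each element of [n]^(2)∖E(K) independently with probability p, and let F = K + E. Then with probability at least 1 − c·n^{−10}: for every pair of distinct x, y ∈ [n] and every integer ℓ with log n ≤ ℓ ≤ 10·log n, the number of (F∖K, K)-alternating x,y-paths of length 2ℓ is at most (1+η)·d^ℓ·δ^ℓ/n. (Lemma 7.1.) -/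
open scoped Classical ENNReal

noncomputable section

namespace Sandwich

variable {n : ℕ}

/-- `nbrSum G f v` is the sum of `f` over the neighbours of `v`. -/
def nbrSum (G : SimpleGraph (Fin n)) (f : Fin n → ℕ) (v : Fin n) : ℕ :=
  ∑ u, if G.Adj v u then f u else 0

/-- The number of alternating walks of length `k` to `y`, as a function of the first vertex. -/
def altWalks : ℕ → SimpleGraph (Fin n) → SimpleGraph (Fin n) → Fin n → Fin n → ℕ
  | 0, _, _, y => Pi.single y 1
  | k + 1, G₁, G₂, y => nbrSum G₁ (altWalks k G₂ G₁ y)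

lemma card_alternating_le_altWalks (k : ℕ) (G₁ G₂ : SimpleGraph (Fin n)) (x y : Fin n) :
    Nat.card {P : Fin (k + 1) → Fin n // (∀ i : Fin k,
      if (i : ℕ) % 2 = 0 then G₁.Adj (P i.castSucc) (P i.succ)
      else G₂.Adj (P i.castSucc) (P i.succ)) ∧ P 0 = x ∧ P (Fin.last k) = y} ≤
      altWalks k G₁ G₂ y x := by
  induction k generalizing G₁ G₂ x with
  | zero =>
    by_cases h : x = y
    · subst h
      simp only [altWalks, Pi.single_eq_same]
      rw [Finite.card_le_one_iff_subsingleton]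
      refine ⟨fun P Q => Subtype.ext (funext fun i => ?_)⟩
      rw [Fin.fin_one_eq_zero i, P.2.2.1, Q.2.2.1]
    · rw [Nat.card_eq_zero.2]
      · exact Nat.zero_le _
      · left
        refine ⟨fun P => h ?_⟩
        exact P.2.2.1.symm.trans P.2.2.2
  | succ k ih =>
    let f : {P : Fin (k + 1 + 1) → Fin n // (∀ i : Fin (k + 1),
        if (i : ℕ) % 2 = 0 then G₁.Adj (P i.castSucc) (P i.succ)
        else G₂.Adj (P i.castSucc) (P i.succ)) ∧ P 0 = x ∧ P (Fin.last (k + 1)) = y} →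
        Σ v : {v : Fin n // G₁.Adj x v}, {P : Fin (k + 1) → Fin n // (∀ i : Fin k,
          if (i : ℕ) % 2 = 0 then G₂.Adj (P i.castSucc) (P i.succ)
          else G₁.Adj (P i.castSucc) (P i.succ)) ∧ P 0 = v ∧ P (Fin.last k) = y} :=
      fun P => ⟨⟨P.1 1, by
        have := P.2.1 0
        simpa [P.2.2.1] using this⟩, ⟨fun i => P.1 i.succ, by
          refine ⟨fun i => ?_, rfl, by simpa using P.2.2.2⟩
          have := P.2.1 i.succ
          have h2 : ((i.succ : Fin (k + 1)) : ℕ) = i + 1 := rfl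
          rw [h2] at this
          rcases Nat.mod_two_eq_zero_or_one i with h | h
          · have h' : ((i : ℕ) + 1) % 2 ≠ 0 := by omega
            rw [if_neg h'] at this
            rw [if_pos h]; exact this
          · have h' : ((i : ℕ) + 1) % 2 = 0 := by omega
            rw [if_pos h'] at this
            rw [if_neg (by omega)]; exact this⟩⟩
    have hf : Function.Injective f := by
      intro P Q hPQ
      have h2 : ∀ i : Fin (k + 1), P.1 i.succ = Q.1 i.succ := by
        intro i
        exact congrArg (fun z => z.2.1 i) hPQ
      refine Subtype.ext (funext fun i => ?_)
      refine Fin.cases ?_ h2 i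
      rw [P.2.2.1, Q.2.2.1]
    refine (Nat.card_le_card_of_injective f hf).trans ?_
    rw [Nat.card_sigma]
    refine (Finset.sum_le_sum fun v _ => ih G₂ G₁ v.1).trans ?_
    simp only [altWalks, nbrSum]
    rw [← Finset.sum_filter, Finset.sum_subtype (p := fun v => G₁.Adj x v)]
    simp

lemma altPathCount_le_altWalks (k : ℕ) (G₁ G₂ : SimpleGraph (Fin n)) (x y : Fin n) :
    altPathCount G₁ G₂ k x y ∅ ≤ altWalks k G₁ G₂ y x := by
  refine le_trans ?_ (card_alternating_le_altWalks k G₁ G₂ x y)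
  refine Nat.card_le_card_of_injective
    (fun P => ⟨P.1, P.2.1.2, P.2.2.1, P.2.2.2.1⟩) ?_
  intro P Q h
  exact Subtype.ext (congrArg (fun z => z.1) h)

lemma sum_mul_nbrSum (G : SimpleGraph (Fin n)) (f g : Fin n → ℕ) :
    ∑ v, f v * nbrSum G g v = ∑ v, nbrSum G f v * g v := by
  simp only [nbrSum, Finset.mul_sum, Finset.sum_mul]
  rw [Finset.sum_comm]
  refine Finset.sum_congr rfl fun u _ => Finset.sum_congr rfl fun v _ => ?_
  by_cases h : G.Adj u v
  · simp [h, h.symm]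
  · simp [h, G.adj_comm v u]

/-- The number of alternating walks is obtained by splitting the walk at an edge of `A`. -/
lemma altWalks_two_mul (A B : SimpleGraph (Fin n)) (a b : ℕ) (x y : Fin n) :
    altWalks (2 * (a + b + 1)) A B y x =
      ∑ v, ((nbrSum B ∘ nbrSum A)^[a] (Pi.single x 1)) v *
        nbrSum A ((nbrSum B ∘ nbrSum A)^[b] (nbrSum B (Pi.single y 1))) v := by
  have h1 : ∀ k, altWalks (2 * k) A B y = (nbrSum A ∘ nbrSum B)^[k] (Pi.single y 1) := by
    intro k
    induction k with
    | zero => rfl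
    | succ k ih =>
      rw [Function.iterate_succ_apply', ← ih]
      rfl
  have h2 : ∀ k f g, ∑ v, f v * ((nbrSum A ∘ nbrSum B)^[k] g) v =
      ∑ v, ((nbrSum B ∘ nbrSum A)^[k] f) v * g v := by
    intro k
    induction k with
    | zero => intro f g; rfl
    | succ k ih =>
      intro f g
      rw [Function.iterate_succ_apply', Function.iterate_succ_apply, ← ih]
      simp only [Function.comp_apply]
      rw [sum_mul_nbrSum, sum_mul_nbrSum]
  have h3 : ∀ k f, nbrSum A ((nbrSum B ∘ nbrSum A)^[k] (nbrSum B f)) =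
      (nbrSum A ∘ nbrSum B)^[k + 1] f := by
    intro k
    induction k with
    | zero => intro f; rfl
    | succ k ih =>
      intro f
      rw [Function.iterate_succ_apply', Function.iterate_succ_apply', ← ih]
      rfl
  rw [h1, h3, ← h2, ← Function.iterate_add_apply, ← add_assoc]
  simp [Pi.single_apply]

lemma sum_range_indicator_le (U : ℕ) (y : ℝ) (hy : 0 ≤ y) :
    ∑ s ∈ Finset.range U, (if (s : ℝ) + 1 ≤ y then (1 : ℝ) else 0) ≤ y := by
  rw [Finset.sum_boole]
  have : (Finset.range U).filter (fun s : ℕ => (s : ℝ) + 1 ≤ y) ⊆ Finset.range ⌊y⌋₊ := by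
    intro s hs
    rw [Finset.mem_filter] at hs
    rw [Finset.mem_range, ← Nat.succ_le_iff]
    refine Nat.le_floor ?_
    push_cast
    exact hs.2
  have h2 := Finset.card_le_card this
  rw [Finset.card_range] at h2
  exact le_trans (by exact_mod_cast h2) (Nat.floor_le hy)

lemma sum_range_lt (U k : ℕ) (h : k ≤ U) (f : ℕ → ℝ) :
    ∑ s ∈ Finset.range U, (if s < k then f s else 0) = ∑ s ∈ Finset.range k, f s := by
  rw [← Finset.sum_filter]
  congr 1
  ext s
  simp
  omega

lemma sum_level_sets_le (u : Fin n → ℕ) (U : ℕ) (hU : ∀ x, u x ≤ U) :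
    ∑ s ∈ Finset.range U, ((s : ℝ) + 1) * ((Finset.univ.filter (fun x => s < u x)).card : ℝ) ≤
      ∑ x, (u x : ℝ) ^ 2 := by
  have h1 : ∀ s : ℕ, ((s : ℝ) + 1) * ((Finset.univ.filter (fun x => s < u x)).card : ℝ) =
      ∑ x, if s < u x then ((s : ℝ) + 1) else 0 := by
    intro s
    rw [← Finset.sum_filter, Finset.sum_const, nsmul_eq_mul, mul_comm]
  simp_rw [h1]
  rw [Finset.sum_comm]
  refine Finset.sum_le_sum fun x _ => ?_
  rw [sum_range_lt U _ (hU x) (fun s => (s : ℝ) + 1)]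
  calc _ ≤ ∑ s ∈ Finset.range (u x), (u x : ℝ) := by
        refine Finset.sum_le_sum fun s hs => ?_
        have := Finset.mem_range.1 hs
        exact_mod_cast this
    _ = _ := by simp [sq]

lemma sum_level_sets_eq (u : Fin n → ℕ) (U : ℕ) (hU : ∀ x, u x ≤ U) :
    ∑ s ∈ Finset.range U, ((Finset.univ.filter (fun x => s < u x)).card : ℝ) =
      ∑ x, (u x : ℝ) := by
  have h1 : ∀ s : ℕ, ((Finset.univ.filter (fun x => s < u x)).card : ℝ) =
      ∑ x, if s < u x then (1 : ℝ) else 0 := by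
    intro s
    rw [Finset.sum_boole]
  simp_rw [h1]
  rw [Finset.sum_comm]
  refine Finset.sum_congr rfl fun x _ => ?_
  rw [sum_range_lt U _ (hU x) (fun s => (1 : ℝ))]
  simp

/-- The number of ordered pairs in `S × T` that are edges of `A`. -/
def pairCount (A : SimpleGraph (Fin n)) (S T : Finset (Fin n)) : ℝ :=
  ∑ u ∈ S, ∑ v ∈ T, if A.Adj u v then (1 : ℝ) else 0

lemma sum_mul_nbrSum_eq_level_sets (A : SimpleGraph (Fin n)) (u w : Fin n → ℕ) (U : ℕ)
    (hu : ∀ x, u x ≤ U) (hw : ∀ x, w x ≤ U) :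
    ((∑ x, u x * nbrSum A w x : ℕ) : ℝ) =
      ∑ s ∈ Finset.range U, ∑ t ∈ Finset.range U,
        pairCount A (Finset.univ.filter (fun x => s < u x))
          (Finset.univ.filter (fun x => t < w x)) := by
  have h1 : ∀ s t, pairCount A (Finset.univ.filter (fun x => s < u x))
      (Finset.univ.filter (fun x => t < w x)) =
      ∑ x, ∑ y, if A.Adj x y then (if s < u x then (1 : ℝ) else 0) *
        (if t < w y then (1 : ℝ) else 0) else 0 := by
    intro s t
    simp only [pairCount, Finset.sum_filter]
    refine Finset.sum_congr rfl fun x _ => ?_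
    by_cases h : s < u x
    · simp only [h, if_true]
      refine Finset.sum_congr rfl fun y _ => ?_
      by_cases h' : t < w y <;> by_cases h'' : A.Adj x y <;> simp [h', h'']
    · simp [h]
  simp_rw [h1]
  have h2 : ∀ x y, ∑ s ∈ Finset.range U, ∑ t ∈ Finset.range U,
      (if A.Adj x y then (if s < u x then (1 : ℝ) else 0) *
        (if t < w y then (1 : ℝ) else 0) else 0) =
      if A.Adj x y then (u x : ℝ) * (w y : ℝ) else 0 := by
    intro x y
    by_cases h : A.Adj x y
    · simp only [h, if_true]
      rw [← Finset.sum_mul_sum, sum_range_lt U _ (hu x) (fun s => (1 : ℝ)),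
        sum_range_lt U _ (hw y) (fun s => (1 : ℝ))]
      simp
    · simp [h]
  have h3 : ∑ s ∈ Finset.range U, ∑ t ∈ Finset.range U, ∑ x, ∑ y,
      (if A.Adj x y then (if s < u x then (1 : ℝ) else 0) *
        (if t < w y then (1 : ℝ) else 0) else 0) =
      ∑ x, ∑ y, ∑ s ∈ Finset.range U, ∑ t ∈ Finset.range U,
      (if A.Adj x y then (if s < u x then (1 : ℝ) else 0) *
        (if t < w y then (1 : ℝ) else 0) else 0) := by
    rw [Finset.sum_congr rfl (fun s _ => Finset.sum_comm), Finset.sum_comm]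
    refine Finset.sum_congr rfl fun x _ => ?_
    rw [Finset.sum_congr rfl (fun s _ => Finset.sum_comm), Finset.sum_comm]
  rw [h3]
  simp_rw [h2]
  push_cast [nbrSum]
  simp_rw [Finset.mul_sum, mul_ite, mul_zero]

lemma pairCount_comm (A : SimpleGraph (Fin n)) (S T : Finset (Fin n)) :
    pairCount A S T = pairCount A T S := by
  unfold pairCount
  rw [Finset.sum_comm]
  simp_rw [A.adj_comm]

lemma pairCount_le_mul_card (A : SimpleGraph (Fin n)) (Δ : ℝ)
    (hΔ : ∀ x, pairCount A {x} Finset.univ ≤ Δ) (S T : Finset (Fin n)) :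
    pairCount A S T ≤ Δ * S.card := by
  calc pairCount A S T ≤ ∑ u ∈ S, Δ := by
        refine Finset.sum_le_sum fun u _ => le_trans ?_ (hΔ u)
        simp only [pairCount, Finset.sum_singleton]
        refine Finset.sum_le_sum_of_subset_of_nonneg (Finset.subset_univ _) ?_
        intros; positivity
    _ = _ := by simp [mul_comm]

/-- Discrepancy and degree bounds control the bilinear form of the adjacency matrix on
nonnegative integer vectors. -/
lemma bilinear_le_of_discrepancy (A : SimpleGraph (Fin n)) (p α Δ R : ℝ) (hp : 0 ≤ p)
    (hα : 0 ≤ α) (hΔ0 : 0 ≤ Δ) (hR : 0 < R)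
    (hΔ : ∀ x, pairCount A {x} Finset.univ ≤ Δ)
    (hdisc : ∀ S T : Finset (Fin n),
      pairCount A S T ≤ p * S.card * T.card + α * (S.card + T.card))
    (u w : Fin n → ℕ) :
    ((∑ x, u x * nbrSum A w x : ℕ) : ℝ) ≤ p * (∑ x, (u x : ℝ)) * (∑ x, (w x : ℝ)) +
      (2 * α * R + 2 * Δ / R) * (√(∑ x, (u x : ℝ) ^ 2) * √(∑ x, (w x : ℝ) ^ 2)) := by
  obtain ⟨U, hu, hw⟩ : ∃ U, (∀ x, u x ≤ U) ∧ (∀ x, w x ≤ U) := by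
    refine ⟨∑ x, (u x + w x), fun x => ?_, fun x => ?_⟩
    · exact le_trans (Nat.le_add_right _ _)
        (Finset.single_le_sum (f := fun x => u x + w x) (fun _ _ => Nat.zero_le _)
          (Finset.mem_univ x))
    · exact le_trans (Nat.le_add_left _ _)
        (Finset.single_le_sum (f := fun x => u x + w x) (fun _ _ => Nat.zero_le _)
          (Finset.mem_univ x))
  set a := √(∑ x, (u x : ℝ) ^ 2) with ha
  set b := √(∑ x, (w x : ℝ) ^ 2) with hb
  have ha2 : ∑ x, (u x : ℝ) ^ 2 = a ^ 2 := (Real.sq_sqrt (by positivity)).symm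
  have hb2 : ∑ x, (w x : ℝ) ^ 2 = b ^ 2 := (Real.sq_sqrt (by positivity)).symm
  have ha0 : 0 ≤ a := Real.sqrt_nonneg _
  have hb0 : 0 ≤ b := Real.sqrt_nonneg _
  have hrhs : 0 ≤ p * (∑ x, (u x : ℝ)) * (∑ x, (w x : ℝ)) +
      (2 * α * R + 2 * Δ / R) * (a * b) := by positivity
  rcases ha0.eq_or_lt with ha' | hapos
  · have : ∀ x, u x = 0 := by
      intro x
      rw [← ha'] at ha2
      have := (Finset.sum_eq_zero_iff_of_nonneg (fun _ _ => by positivity)).1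
        (ha2.trans (by norm_num)) x (Finset.mem_univ _)
      simpa using this
    refine le_trans (le_of_eq ?_) hrhs
    simp [this]
  rcases hb0.eq_or_lt with hb' | hbpos
  · have : ∀ x, w x = 0 := by
      intro x
      rw [← hb'] at hb2
      have := (Finset.sum_eq_zero_iff_of_nonneg (fun _ _ => by positivity)).1
        (hb2.trans (by norm_num)) x (Finset.mem_univ _)
      simpa using this
    refine le_trans (le_of_eq ?_) hrhs
    simp [this, nbrSum]
  set S : ℕ → Finset (Fin n) := fun s => Finset.univ.filter (fun x => s < u x) with hS
  set T : ℕ → Finset (Fin n) := fun t => Finset.univ.filter (fun x => t < w x) with hT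
  set q := a / b with hq
  have hqpos : 0 < q := by positivity
  have cn : ∀ X : Finset (Fin n), (0 : ℝ) ≤ X.card := fun X => Nat.cast_nonneg _
  have ite_n : ∀ P : Prop, (0 : ℝ) ≤ if P then 1 else 0 := fun P => by split_ifs <;> norm_num
  have hpt : ∀ s t : ℕ, pairCount A (S s) (T t) ≤ p * ((S s).card * (T t).card) +
      (Δ * (T t).card * (if (s : ℝ) + 1 ≤ (t + 1) * q / R then 1 else 0) +
      Δ * (S s).card * (if (t : ℝ) + 1 ≤ (s + 1) / (q * R) then 1 else 0) +
      α * (S s).card * (if (t : ℝ) + 1 ≤ (s + 1) * R / q then 1 else 0) +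
      α * (T t).card * (if (s : ℝ) + 1 ≤ (t + 1) * (q * R) then 1 else 0)) := by
    intro s t
    have n1 : 0 ≤ p * ((S s).card * (T t).card : ℝ) := mul_nonneg hp (mul_nonneg (cn _) (cn _))
    have n2 := mul_nonneg (mul_nonneg hΔ0 (cn (T t))) (ite_n ((s : ℝ) + 1 ≤ (t + 1) * q / R))
    have n3 := mul_nonneg (mul_nonneg hΔ0 (cn (S s))) (ite_n ((t : ℝ) + 1 ≤ (s + 1) / (q * R)))
    have n4 := mul_nonneg (mul_nonneg hα (cn (S s))) (ite_n ((t : ℝ) + 1 ≤ (s + 1) * R / q))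
    have n5 := mul_nonneg (mul_nonneg hα (cn (T t))) (ite_n ((s : ℝ) + 1 ≤ (t + 1) * (q * R)))
    by_cases c1 : (s : ℝ) + 1 ≤ (t + 1) * q / R
    · have := pairCount_le_mul_card A Δ hΔ (T t) (S s)
      rw [pairCount_comm] at this
      rw [if_pos c1] at n2 ⊢
      linarith
    by_cases c2 : (t : ℝ) + 1 ≤ (s + 1) / (q * R)
    · have := pairCount_le_mul_card A Δ hΔ (S s) (T t)
      rw [if_pos c2] at n3 ⊢
      linarith
    · have c3 : (t : ℝ) + 1 ≤ (s + 1) * R / q := by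
        rw [le_div_iff₀ hqpos]
        rw [not_le, div_lt_iff₀ hR] at c1
        exact c1.le
      have c4 : (s : ℝ) + 1 ≤ (t + 1) * (q * R) := by
        rw [not_le, div_lt_iff₀ (by positivity)] at c2
        exact c2.le
      have := hdisc (S s) (T t)
      rw [if_pos c3, if_pos c4]
      linarith
  have hmain := sum_mul_nbrSum_eq_level_sets A u w U hu hw
  rw [hmain]
  refine le_trans (Finset.sum_le_sum fun s _ => Finset.sum_le_sum fun t _ => hpt s t) ?_
  simp only [Finset.sum_add_distrib]
  have e0 : ∑ s ∈ Finset.range U, ∑ t ∈ Finset.range U, p * ((S s).card * (T t).card : ℝ) =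
      p * (∑ x, (u x : ℝ)) * (∑ x, (w x : ℝ)) := by
    rw [← sum_level_sets_eq u U hu, ← sum_level_sets_eq w U hw, mul_assoc, Finset.sum_mul_sum]
    simp_rw [Finset.mul_sum]
    rfl
  have key : ∀ (g : ℕ → ℝ) (y : ℕ → ℝ) (c k z : ℝ), 0 ≤ c → 0 ≤ k → (∀ t, 0 ≤ g t) →
      (∀ t : ℕ, y t = (t + 1) * k) → ∑ t ∈ Finset.range U, ((t : ℝ) + 1) * g t ≤ z →
      ∑ t ∈ Finset.range U, ∑ s ∈ Finset.range U,
        c * g t * (if (s : ℝ) + 1 ≤ y t then 1 else 0) ≤ c * k * z := by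
    intro g y c k z hc hk hg hy hz
    calc _ ≤ ∑ t ∈ Finset.range U, c * g t * y t := by
          refine Finset.sum_le_sum fun t _ => ?_
          rw [← Finset.mul_sum]
          refine mul_le_mul_of_nonneg_left (sum_range_indicator_le U _ ?_)
            (mul_nonneg hc (hg t))
          rw [hy]; positivity
      _ = c * k * ∑ t ∈ Finset.range U, ((t : ℝ) + 1) * g t := by
          rw [Finset.mul_sum]
          refine Finset.sum_congr rfl fun t _ => ?_
          rw [hy]; ring
      _ ≤ _ := by gcongr
  have zu := sum_level_sets_le u U hu
  have zw := sum_level_sets_le w U hw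
  rw [ha2] at zu
  rw [hb2] at zw
  have e1 := key (fun t => ((T t).card : ℝ)) (fun t => (t + 1) * q / R) Δ (q / R) _ hΔ0
    (by positivity) (fun t => cn _) (fun t => by ring) zw
  have e2 := key (fun s => ((S s).card : ℝ)) (fun s => (s + 1) / (q * R)) Δ (1 / (q * R)) _ hΔ0
    (by positivity) (fun t => cn _) (fun t => by ring) zu
  have e3 := key (fun s => ((S s).card : ℝ)) (fun s => (s + 1) * R / q) α (R / q) _ hα
    (by positivity) (fun t => cn _) (fun t => by ring) zu
  have e4 := key (fun t => ((T t).card : ℝ)) (fun t => (t + 1) * (q * R)) α (q * R) _ hα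
    (by positivity) (fun t => cn _) (fun t => by ring) zw
  rw [Finset.sum_comm] at e1 e4
  rw [e0]
  have f1 : Δ * (q / R) * b ^ 2 = Δ / R * (a * b) := by rw [hq]; field_simp
  have f2 : Δ * (1 / (q * R)) * a ^ 2 = Δ / R * (a * b) := by rw [hq]; field_simp
  have f3 : α * (R / q) * a ^ 2 = α * R * (a * b) := by rw [hq]; field_simp
  have f4 : α * (q * R) * b ^ 2 = α * R * (a * b) := by rw [hq]; field_simp
  rw [f1] at e1; rw [f2] at e2; rw [f3] at e3; rw [f4] at e4
  have : (2 * α * R + 2 * Δ / R) * (a * b) =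
    Δ / R * (a * b) + Δ / R * (a * b) + α * R * (a * b) + α * R * (a * b) := by ring
  rw [this]
  linarith

lemma isRegularGraph_sum_ite {B : SimpleGraph (Fin n)} {d : ℕ} (hB : IsRegularGraph B d)
    (v : Fin n) (c : ℝ) : ∑ u, (if B.Adj v u then c else 0) = d * c := by
  have h := hB v
  rw [deg, Nat.card_eq_fintype_card, ← Set.toFinset_card] at h
  rw [← Finset.sum_filter, Finset.sum_const, nsmul_eq_mul, ← h]
  congr 3
  ext u
  simp

/-- `wNbrSum G h v` is the sum of the real function `h` over the neighbours of `v`. -/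
def wNbrSum (G : SimpleGraph (Fin n)) (h : Fin n → ℝ) (v : Fin n) : ℝ :=
  ∑ u, if G.Adj v u then h u else 0

lemma sum_nbrSum_mul (G : SimpleGraph (Fin n)) (f : Fin n → ℕ) (h : Fin n → ℝ) :
    ∑ v, (nbrSum G f v : ℝ) * h v = ∑ v, (f v : ℝ) * wNbrSum G h v := by
  simp only [nbrSum, wNbrSum, Finset.mul_sum, Nat.cast_sum, Finset.sum_mul]
  rw [Finset.sum_comm]
  refine Finset.sum_congr rfl fun u _ => Finset.sum_congr rfl fun v _ => ?_
  by_cases h : G.Adj u v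
  · simp [h, h.symm]
  · simp [h, G.adj_comm v u]

lemma sum_nbrSum_regular {B : SimpleGraph (Fin n)} {d : ℕ} (hB : IsRegularGraph B d)
    (f : Fin n → ℕ) : ∑ v, (nbrSum B f v : ℝ) = d * ∑ v, (f v : ℝ) := by
  have h := sum_nbrSum_mul B f (fun _ => 1)
  simp only [mul_one, wNbrSum, isRegularGraph_sum_ite hB] at h
  rw [h, ← Finset.sum_mul, mul_comm]

lemma sqrt_sum_sq_nbrSum_le {B : SimpleGraph (Fin n)} {d : ℕ} (hB : IsRegularGraph B d)
    (f : Fin n → ℕ) :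
    √(∑ v, (nbrSum B f v : ℝ) ^ 2) ≤ d * √(∑ v, (f v : ℝ) ^ 2) := by
  have h1 : ∀ v, (nbrSum B f v : ℝ) ^ 2 ≤ d * (nbrSum B (fun u => f u ^ 2) v : ℝ) := by
    intro v
    have h2 := Finset.sum_mul_sq_le_sq_mul_sq Finset.univ
      (fun u => if B.Adj v u then (1 : ℝ) else 0) (fun u => if B.Adj v u then (f u : ℝ) else 0)
    have e1 : ∀ u, (if B.Adj v u then (1 : ℝ) else 0) * (if B.Adj v u then (f u : ℝ) else 0) =
        if B.Adj v u then (f u : ℝ) else 0 := by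
      intro u; split_ifs <;> simp
    have e2 : ∀ u, (if B.Adj v u then (1 : ℝ) else 0) ^ 2 = if B.Adj v u then (1 : ℝ) else 0 := by
      intro u; split_ifs <;> simp
    have e3 : ∀ u, (if B.Adj v u then (f u : ℝ) else 0) ^ 2 =
        if B.Adj v u then (f u : ℝ) ^ 2 else 0 := by
      intro u; split_ifs <;> simp
    simp only [e1, e2, e3, isRegularGraph_sum_ite hB, mul_one] at h2
    simpa [nbrSum] using h2
  rw [← Real.sqrt_sq (Nat.cast_nonneg d : (0 : ℝ) ≤ d), ← Real.sqrt_mul (by positivity)]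
  refine Real.sqrt_le_sqrt ?_
  calc _ ≤ ∑ v, d * (nbrSum B (fun u => f u ^ 2) v : ℝ) := Finset.sum_le_sum fun v _ => h1 v
    _ = _ := by
      rw [← Finset.mul_sum, sum_nbrSum_regular hB]
      push_cast
      ring

section Growth

variable {A B : SimpleGraph (Fin n)} {d : ℕ}

lemma sum_iterate_mul_le (φ : Fin n → ℝ) (lam : ℝ) (hlam : 0 ≤ lam)
    (hφ : ∀ x, wNbrSum A (wNbrSum B φ) x ≤ lam * φ x) (f : Fin n → ℕ) (a : ℕ) :
    ∑ v, (((nbrSum B ∘ nbrSum A)^[a] f) v : ℝ) * φ v ≤ lam ^ a * ∑ v, (f v : ℝ) * φ v := by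
  induction a with
  | zero => simp
  | succ a ih =>
    rw [Function.iterate_succ_apply']
    simp only [Function.comp_apply]
    rw [sum_nbrSum_mul, sum_nbrSum_mul]
    calc _ ≤ ∑ v, (((nbrSum B ∘ nbrSum A)^[a] f) v : ℝ) * (lam * φ v) :=
          Finset.sum_le_sum fun v _ => mul_le_mul_of_nonneg_left (hφ v) (Nat.cast_nonneg _)
      _ = lam * ∑ v, (((nbrSum B ∘ nbrSum A)^[a] f) v : ℝ) * φ v := by
          rw [Finset.mul_sum]
          refine Finset.sum_congr rfl fun v _ => by ring
      _ ≤ lam * (lam ^ a * ∑ v, (f v : ℝ) * φ v) := mul_le_mul_of_nonneg_left ih hlam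
      _ = _ := by ring

lemma sum_iterate_le (hB : IsRegularGraph B d) (φ : Fin n → ℝ) (lam G : ℝ) (hlam : 0 ≤ lam)
    (hG : 1 ≤ G) (hφ : ∀ x, wNbrSum A (wNbrSum B φ) x ≤ lam * φ x)
    (hdeg : ∀ x, wNbrSum A (fun _ => 1) x ≤ φ x) (hφG : ∀ x, d * φ x ≤ G * lam)
    (f : Fin n → ℕ) (a : ℕ) :
    ∑ v, (((nbrSum B ∘ nbrSum A)^[a] f) v : ℝ) ≤ G * lam ^ a * ∑ v, (f v : ℝ) := by
  have hf : 0 ≤ ∑ v, (f v : ℝ) := Finset.sum_nonneg fun _ _ => Nat.cast_nonneg _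
  cases a with
  | zero =>
    simp only [Function.iterate_zero, id_eq, pow_zero, mul_one]
    exact le_mul_of_one_le_left hf hG
  | succ a =>
    rw [Function.iterate_succ_apply']
    simp only [Function.comp_apply]
    rw [sum_nbrSum_regular hB]
    have h1 := sum_nbrSum_mul A ((nbrSum B ∘ nbrSum A)^[a] f) (fun _ => 1)
    simp only [mul_one] at h1
    rw [h1]
    calc _ ≤ d * ∑ v, (((nbrSum B ∘ nbrSum A)^[a] f) v : ℝ) * φ v := by
          gcongr with v
          exact hdeg v
      _ ≤ d * (lam ^ a * ∑ v, (f v : ℝ) * φ v) := by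
          gcongr
          exact sum_iterate_mul_le φ lam hlam hφ f a
      _ = lam ^ a * ∑ v, (f v : ℝ) * (d * φ v) := by
          simp only [Finset.mul_sum]
          refine Finset.sum_congr rfl fun v _ => by ring
      _ ≤ lam ^ a * ∑ v, (f v : ℝ) * (G * lam) := by
          refine mul_le_mul_of_nonneg_left (Finset.sum_le_sum fun v _ => ?_) (by positivity)
          exact mul_le_mul_of_nonneg_left (hφG v) (Nat.cast_nonneg _)
      _ = _ := by
          rw [← Finset.sum_mul]
          ring

lemma sqrt_sum_sq_step_le (hB : IsRegularGraph B d) (p κ : ℝ) (hp : 0 ≤ p) (hκ : 0 ≤ κ)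
    (hbil : ∀ u w : Fin n → ℕ, ((∑ x, u x * nbrSum A w x : ℕ) : ℝ) ≤
      p * (∑ x, (u x : ℝ)) * (∑ x, (w x : ℝ)) +
        κ * (√(∑ x, (u x : ℝ) ^ 2) * √(∑ x, (w x : ℝ) ^ 2))) (f : Fin n → ℕ) :
    √(∑ v, (nbrSum B (nbrSum A f) v : ℝ) ^ 2) ≤
      p * d * √n * ∑ v, (f v : ℝ) + κ * d * √(∑ v, (f v : ℝ) ^ 2) := by
  set g := nbrSum B (nbrSum A f) with hg
  set b := √(∑ v, (g v : ℝ) ^ 2) with hb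
  have hf : 0 ≤ ∑ v, (f v : ℝ) := Finset.sum_nonneg fun _ _ => Nat.cast_nonneg _
  have hb0 : 0 ≤ b := Real.sqrt_nonneg _
  have hb2 : ∑ v, (g v : ℝ) ^ 2 = b ^ 2 := (Real.sq_sqrt (by positivity)).symm
  have hl1 : ∑ v, (g v : ℝ) ≤ √n * b := by
    have := Finset.sum_mul_sq_le_sq_mul_sq Finset.univ (fun _ : Fin n => (1 : ℝ))
      (fun v => (g v : ℝ))
    simp only [one_mul, one_pow, Finset.sum_const, Finset.card_univ, Fintype.card_fin,
      nsmul_eq_mul, mul_one] at this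
    rw [hb, ← Real.sqrt_mul (Nat.cast_nonneg n)]
    exact Real.le_sqrt_of_sq_le this
  have h1 : b ^ 2 ≤ (p * d * √n * ∑ v, (f v : ℝ) + κ * d * √(∑ v, (f v : ℝ) ^ 2)) * b := by
    have h2 : ((∑ v, g v * nbrSum B (nbrSum A f) v : ℕ) : ℝ) = b ^ 2 := by
      rw [← hg, ← hb2]
      push_cast
      refine Finset.sum_congr rfl fun v _ => by ring
    rw [sum_mul_nbrSum] at h2
    rw [← h2]
    refine (hbil (nbrSum B g) f).trans ?_
    rw [sum_nbrSum_regular hB]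
    calc _ ≤ p * (d * (√n * b)) * (∑ v, (f v : ℝ)) +
          κ * ((d * b) * √(∑ v, (f v : ℝ) ^ 2)) := by
          gcongr
          exact sqrt_sum_sq_nbrSum_le hB g
      _ = _ := by ring
  rcases hb0.eq_or_lt with h | h
  · rw [← h]; positivity
  · rw [sq] at h1
    exact le_of_mul_le_mul_right h1 h

lemma sqrt_sum_sq_iterate_le (hn : 0 < n) (hB : IsRegularGraph B d)
    (p κ k lam G : ℝ) (hp : 0 ≤ p) (hκ : 0 ≤ κ) (hk : 0 ≤ k) (hk2 : k ≤ 1 / 2) (hlam : 0 ≤ lam)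
    (hbil : ∀ u w : Fin n → ℕ, ((∑ x, u x * nbrSum A w x : ℕ) : ℝ) ≤
      p * (∑ x, (u x : ℝ)) * (∑ x, (w x : ℝ)) +
        κ * (√(∑ x, (u x : ℝ) ^ 2) * √(∑ x, (w x : ℝ) ^ 2)))
    (hκk : κ * d ≤ k * lam) (hpG : p * n * d * G ≤ 4 * lam)
    (hl1 : ∀ (f : Fin n → ℕ) (a : ℕ),
      ∑ v, (((nbrSum B ∘ nbrSum A)^[a] f) v : ℝ) ≤ G * lam ^ a * ∑ v, (f v : ℝ))
    (f : Fin n → ℕ) (a : ℕ) :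
    √(∑ v, (((nbrSum B ∘ nbrSum A)^[a] f) v : ℝ) ^ 2) ≤
      lam ^ a * (∑ v, (f v : ℝ)) * (k ^ a + 8 / √n) := by
  have hf : 0 ≤ ∑ v, (f v : ℝ) := Finset.sum_nonneg fun _ _ => Nat.cast_nonneg _
  have hsn : 0 < √(n : ℝ) := Real.sqrt_pos.2 (by exact_mod_cast hn)
  induction a with
  | zero =>
    simp only [Function.iterate_zero, id_eq, pow_zero, one_mul]
    have h1 : √(∑ v, (f v : ℝ) ^ 2) ≤ ∑ v, (f v : ℝ) := by
      rw [Real.sqrt_le_left hf]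
      exact Finset.sum_sq_le_sq_sum_of_nonneg fun _ _ => Nat.cast_nonneg _
    refine h1.trans (le_mul_of_one_le_right hf ?_)
    have : 0 ≤ 8 / √(n : ℝ) := by positivity
    linarith
  | succ a ih =>
    rw [Function.iterate_succ_apply']
    simp only [Function.comp_apply]
    refine (sqrt_sum_sq_step_le hB p κ hp hκ hbil _).trans ?_
    have e1 : p * d * √n * (G * lam ^ a * ∑ v, (f v : ℝ)) ≤
        lam ^ (a + 1) * (∑ v, (f v : ℝ)) * (4 / √n) := by
      have : p * d * √n * G ≤ lam * (4 / √n) := by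
        rw [mul_div_assoc', le_div_iff₀ hsn]
        calc p * d * √n * G * √n = p * (√n * √n) * d * G := by ring
          _ = p * n * d * G := by rw [Real.mul_self_sqrt (Nat.cast_nonneg n)]
          _ ≤ _ := by linarith
      calc _ = p * d * √n * G * (lam ^ a * ∑ v, (f v : ℝ)) := by ring
        _ ≤ lam * (4 / √n) * (lam ^ a * ∑ v, (f v : ℝ)) := by gcongr
        _ = _ := by ring
    have e2 : κ * d * (lam ^ a * (∑ v, (f v : ℝ)) * (k ^ a + 8 / √n)) ≤
        lam ^ (a + 1) * (∑ v, (f v : ℝ)) * (k ^ (a + 1) + 4 / √n) := by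
      calc _ ≤ k * lam * (lam ^ a * (∑ v, (f v : ℝ)) * (k ^ a + 8 / √n)) := by gcongr
        _ = lam ^ (a + 1) * (∑ v, (f v : ℝ)) * (k ^ (a + 1) + k * (8 / √n)) := by ring
        _ ≤ lam ^ (a + 1) * (∑ v, (f v : ℝ)) * (k ^ (a + 1) + 1 / 2 * (8 / √n)) := by gcongr
        _ = _ := by ring
    calc _ ≤ p * d * √n * (G * lam ^ a * ∑ v, (f v : ℝ)) +
          κ * d * (lam ^ a * (∑ v, (f v : ℝ)) * (k ^ a + 8 / √n)) := by
          gcongr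
          exact hl1 f a
      _ ≤ lam ^ (a + 1) * (∑ v, (f v : ℝ)) * (4 / √n) +
          lam ^ (a + 1) * (∑ v, (f v : ℝ)) * (k ^ (a + 1) + 4 / √n) := add_le_add e1 e2
      _ = _ := by ring

/-- The number of alternating walks is controlled by a potential `φ` that is almost an
eigenvector of the two-step operator, together with a bound on the bilinear form of `A`. -/
lemma altWalks_le (hn : 0 < n) (hB : IsRegularGraph B d) (φ : Fin n → ℝ)
    (p κ k lam G : ℝ) (hp : 0 ≤ p) (hκ : 0 ≤ κ) (hk : 0 ≤ k) (hk2 : k ≤ 1 / 2) (hlam : 0 ≤ lam)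
    (hG : 1 ≤ G)
    (hbil : ∀ u w : Fin n → ℕ, ((∑ x, u x * nbrSum A w x : ℕ) : ℝ) ≤
      p * (∑ x, (u x : ℝ)) * (∑ x, (w x : ℝ)) +
        κ * (√(∑ x, (u x : ℝ) ^ 2) * √(∑ x, (w x : ℝ) ^ 2)))
    (hκk : κ * d ≤ k * lam) (hpG : p * n * d * G ≤ 4 * lam)
    (hφ : ∀ x, wNbrSum A (wNbrSum B φ) x ≤ lam * φ x)
    (hdeg : ∀ x, wNbrSum A (fun _ => 1) x ≤ φ x) (hφG : ∀ x, d * φ x ≤ G * lam)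
    (a b : ℕ) (ha : k ^ a ≤ 1 / √n) (hb : k ^ b ≤ 1 / √n) (x y : Fin n) :
    (altWalks (2 * (a + b + 1)) A B y x : ℝ) ≤
      lam ^ (a + b) * d * (p * G ^ 2 + 81 * κ / n) := by
  have hl1 := sum_iterate_le hB φ lam G hlam hG hφ hdeg hφG
  have hl2 := sqrt_sum_sq_iterate_le hn hB p κ k lam G hp hκ hk hk2 hlam hbil hκk hpG hl1
  have hx : ∀ z : Fin n, ∑ v, ((Pi.single z 1 : Fin n → ℕ) v : ℝ) = 1 := by
    intro z
    rw [← Nat.cast_sum]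
    simp
  have hy : ∑ v, (nbrSum B (Pi.single y 1) v : ℝ) = d := by
    rw [sum_nbrSum_regular hB, hx, mul_one]
  have hsn : 0 < √(n : ℝ) := Real.sqrt_pos.2 (by exact_mod_cast hn)
  rw [altWalks_two_mul]
  refine (hbil _ _).trans ?_
  have a1 := hl1 (Pi.single x 1) a
  have b1 := hl1 (nbrSum B (Pi.single y 1)) b
  have a2 := hl2 (Pi.single x 1) a
  have b2 := hl2 (nbrSum B (Pi.single y 1)) b
  rw [hx] at a1 a2
  rw [hy] at b1 b2
  have h9 : ∀ c, k ^ c ≤ 1 / √(n : ℝ) → k ^ c + 8 / √n ≤ 9 / √n := by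
    intro c hc
    calc k ^ c + 8 / √n ≤ 1 / √n + 8 / √n := by gcongr
      _ = _ := by ring
  have a3 := a2.trans (mul_le_mul_of_nonneg_left (h9 a ha) (by positivity))
  have b3 := b2.trans (mul_le_mul_of_nonneg_left (h9 b hb) (by positivity))
  calc _ ≤ p * (G * lam ^ a * 1) * (G * lam ^ b * d) +
        κ * ((lam ^ a * 1 * (9 / √n)) * (lam ^ b * d * (9 / √n))) := by
        have s1 : 0 ≤ ∑ v, (((nbrSum B ∘ nbrSum A)^[b] (nbrSum B (Pi.single y 1))) v : ℝ) :=
          Finset.sum_nonneg fun _ _ => Nat.cast_nonneg _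
        gcongr
    _ = lam ^ (a + b) * d * (p * G ^ 2 + 81 * κ / (√n * √n)) := by
        field_simp
        ring
    _ = _ := by rw [Real.mul_self_sqrt (Nat.cast_nonneg n)]

end Growth

section Bernoulli

variable {ι : Type*}

/-- The expectation of `f X`, where `X` is a random subset of `U` containing each element
independently with probability `p`. -/
def bernEx (p : ℝ) (U : Finset ι) (f : Finset ι → ℝ) : ℝ :=
  ∑ X ∈ U.powerset, p ^ X.card * (1 - p) ^ (U \ X).card * f X

/-- The probability of `P X`, where `X` is a random subset of `U` containing each element
independently with probability `p`. -/
def bernPr (p : ℝ) (U : Finset ι) (P : Finset ι → Prop) : ℝ :=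
  bernEx p U fun X => if P X then 1 else 0

variable {p : ℝ} {U : Finset ι}

lemma bernEx_prod (f : ι → ℝ) :
    bernEx p U (fun X => ∏ e ∈ X, f e) = ∏ e ∈ U, (p * f e + (1 - p)) := by
  rw [Finset.prod_add]
  refine Finset.sum_congr rfl fun X _ => ?_
  rw [Finset.prod_mul_distrib, Finset.prod_const, Finset.prod_const]
  ring

lemma bernEx_const (c : ℝ) : bernEx p U (fun _ => c) = c := by
  have h := bernEx_prod (p := p) (U := U) (fun _ => 1)
  simp only [Finset.prod_const_one, mul_one, add_sub_cancel] at h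
  unfold bernEx at h ⊢
  rw [← Finset.sum_mul]
  simp only [mul_one] at h
  rw [h, one_mul]

lemma bernEx_mono (hp0 : 0 ≤ p) (hp1 : p ≤ 1) {f g : Finset ι → ℝ}
    (h : ∀ X, X ⊆ U → f X ≤ g X) : bernEx p U f ≤ bernEx p U g := by
  refine Finset.sum_le_sum fun X hX => ?_
  have : 0 ≤ 1 - p := by linarith
  exact mul_le_mul_of_nonneg_left (h X (Finset.mem_powerset.1 hX)) (by positivity)

lemma bernPr_mono (hp0 : 0 ≤ p) (hp1 : p ≤ 1) {P Q : Finset ι → Prop}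
    (h : ∀ X, X ⊆ U → P X → Q X) : bernPr p U P ≤ bernPr p U Q := by
  refine bernEx_mono hp0 hp1 fun X hX => ?_
  by_cases hP : P X
  · rw [if_pos hP, if_pos (h X hX hP)]
  · rw [if_neg hP]; split_ifs <;> norm_num

lemma bernPr_exists_le (hp0 : 0 ≤ p) (hp1 : p ≤ 1) {κ : Type*} (s : Finset κ)
    (P : κ → Finset ι → Prop) :
    bernPr p U (fun X => ∃ k ∈ s, P k X) ≤ ∑ k ∈ s, bernPr p U (P k) := by
  calc bernPr p U (fun X => ∃ k ∈ s, P k X)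
      ≤ bernEx p U (fun X => ∑ k ∈ s, if P k X then 1 else 0) := by
        refine bernEx_mono hp0 hp1 fun X _ => ?_
        have h0 : ∀ k ∈ s, (0 : ℝ) ≤ if P k X then 1 else 0 := by
          intro k _; split_ifs <;> norm_num
        split_ifs with h
        · obtain ⟨k, hk, hP⟩ := h
          refine le_trans ?_ (Finset.single_le_sum h0 hk)
          rw [if_pos hP]
        · exact Finset.sum_nonneg h0
    _ = _ := by
        unfold bernPr bernEx
        rw [Finset.sum_comm]
        simp_rw [Finset.mul_sum]

lemma bernPr_or_le (hp0 : 0 ≤ p) (hp1 : p ≤ 1) (P Q : Finset ι → Prop) :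
    bernPr p U (fun X => P X ∨ Q X) ≤ bernPr p U P + bernPr p U Q := by
  have h := bernPr_exists_le (U := U) hp0 hp1 Finset.univ (fun b : Bool => if b then P else Q)
  simp only [Finset.mem_univ, true_and, Bool.exists_bool, Fintype.sum_bool] at h
  refine le_trans (bernPr_mono hp0 hp1 fun X _ hX => ?_) h
  simpa [or_comm] using hX

lemma bernEx_union [hι : DecidableEq ι] {U₁ U₂ : Finset ι} (hd : Disjoint U₁ U₂)
    (f : Finset ι → ℝ) :
    bernEx p (U₁ ∪ U₂) f = bernEx p U₁ fun X => bernEx p U₂ fun Y => f (X ∪ Y) := by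
  obtain rfl : hι = fun a b => Classical.propDecidable (a = b) := Subsingleton.elim _ _
  have hd' := Finset.disjoint_left.1 hd
  unfold bernEx
  simp_rw [Finset.mul_sum]
  rw [← Finset.sum_product']
  refine Finset.sum_nbij' (fun X => (X ∩ U₁, X ∩ U₂)) (fun Z => Z.1 ∪ Z.2) ?_ ?_ ?_ ?_ ?_
  · intro X _
    simp
  · intro Z hZ
    simp only [Finset.mem_product, Finset.mem_powerset] at hZ ⊢
    exact Finset.union_subset_union hZ.1 hZ.2
  · intro X hX
    rw [Finset.mem_powerset] at hX
    simp only
    rw [← Finset.inter_union_distrib_left, Finset.inter_eq_left.2 hX]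
  · intro Z hZ
    simp only [Finset.mem_product, Finset.mem_powerset] at hZ
    refine Prod.ext ?_ ?_ <;> ext e <;>
      simp only [Finset.mem_inter, Finset.mem_union] <;>
      have h1 := @hZ.1 e <;> have h2 := @hZ.2 e <;> have h3 := @hd' e <;> tauto
  · intro X hX
    rw [Finset.mem_powerset] at hX
    have e1 : X ∩ U₁ ∪ X ∩ U₂ = X := by
      rw [← Finset.inter_union_distrib_left, Finset.inter_eq_left.2 hX]
    have e2 : (U₁ \ (X ∩ U₁)) ∪ (U₂ \ (X ∩ U₂)) = (U₁ ∪ U₂) \ X := by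
      ext e
      simp only [Finset.mem_union, Finset.mem_sdiff, Finset.mem_inter]
      tauto
    have c1 : X.card = (X ∩ U₁).card + (X ∩ U₂).card := by
      rw [← Finset.card_union_of_disjoint, e1]
      exact hd.mono Finset.inter_subset_right Finset.inter_subset_right
    have c2 : ((U₁ ∪ U₂) \ X).card = (U₁ \ (X ∩ U₁)).card + (U₂ \ (X ∩ U₂)).card := by
      rw [← Finset.card_union_of_disjoint, e2]
      exact hd.mono Finset.sdiff_subset Finset.sdiff_subset
    simp only
    rw [e1, c1, c2, pow_add, pow_add]
    ring

lemma exp_mul_sub_one_le {t M c : ℝ} (hM : 0 < M) (hc0 : 0 ≤ c) (hcM : c ≤ M) :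
    Real.exp (t * c) - 1 ≤ c / M * (Real.exp (t * M) - 1) := by
  have h := convexOn_exp.2 (Set.mem_univ (t * M)) (Set.mem_univ 0)
    (show 0 ≤ c / M by positivity)
    (show 0 ≤ 1 - c / M by rw [sub_nonneg, div_le_one hM]; exact hcM) (by ring)
  simp only [smul_eq_mul, mul_zero, add_zero, Real.exp_zero, mul_one] at h
  have e : c / M * (t * M) = t * c := by field_simp
  rw [e] at h
  linarith

/-- Exponential tail bound for a weighted sum of independent Bernoulli variables. -/
lemma bernPr_sum_ge_le (hp0 : 0 ≤ p) (hp1 : p ≤ 1) (c : ι → ℝ) (M t Y a : ℝ) (hM : 0 < M)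
    (ht : 0 ≤ t) (hc0 : ∀ e ∈ U, 0 ≤ c e) (hcM : ∀ e ∈ U, c e ≤ M)
    (hY : Real.exp (t * M) - 1 ≤ Y * M) :
    bernPr p U (fun X => a ≤ ∑ e ∈ X, c e) ≤
      Real.exp (p * Y * ∑ e ∈ U, c e - t * a) := by
  calc bernPr p U (fun X => a ≤ ∑ e ∈ X, c e)
      ≤ bernEx p U (fun X => Real.exp (-(t * a)) * ∏ e ∈ X, Real.exp (t * c e)) := by
        refine bernEx_mono hp0 hp1 fun X _ => ?_
        rw [← Real.exp_sum, ← Real.exp_add, ← Finset.mul_sum]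
        split_ifs with h
        · rw [Real.one_le_exp_iff]
          nlinarith
        · positivity
    _ = Real.exp (-(t * a)) * ∏ e ∈ U, (p * Real.exp (t * c e) + (1 - p)) := by
        rw [← bernEx_prod]
        unfold bernEx
        rw [Finset.mul_sum]
        refine Finset.sum_congr rfl fun X _ => by ring
    _ ≤ Real.exp (-(t * a)) * ∏ e ∈ U, Real.exp (p * Y * c e) := by
        refine mul_le_mul_of_nonneg_left ?_ (Real.exp_pos _).le
        refine Finset.prod_le_prod (fun e he => ?_) fun e he => ?_
        · have := Real.exp_pos (t * c e)
          have : 0 ≤ 1 - p := by linarith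
          positivity
        · have h1 := exp_mul_sub_one_le (t := t) hM (hc0 e he) (hcM e he)
          have h2 : c e / M * (Real.exp (t * M) - 1) ≤ c e / M * (Y * M) :=
            mul_le_mul_of_nonneg_left hY (div_nonneg (hc0 e he) hM.le)
          have h3 : c e / M * (Y * M) = Y * c e := by field_simp
          have h4 : p * (Real.exp (t * c e) - 1) ≤ p * (Y * c e) :=
            mul_le_mul_of_nonneg_left (by linarith) hp0
          have h5 := Real.add_one_le_exp (p * Y * c e)
          linarith
    _ = _ := by
        rw [← Real.exp_sum, ← Real.exp_add, ← Finset.mul_sum]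
        congr 1
        ring

end Bernoulli

/-- The sum of the weights `f u v` over the ordered pairs with `s(u, v) ∈ X`. -/
def tally (f : Fin n → Fin n → ℝ) (X : Finset (Sym2 (Fin n))) : ℝ :=
  ∑ u, ∑ v, if s(u, v) ∈ X then f u v else 0

lemma tally_eq_sum (f : Fin n → Fin n → ℝ) (X : Finset (Sym2 (Fin n))) :
    tally f X = ∑ e ∈ X, tally f {e} := by
  simp only [tally, Finset.mem_singleton]
  symm
  rw [Finset.sum_comm]
  refine Finset.sum_congr rfl fun u _ => ?_
  rw [Finset.sum_comm]
  refine Finset.sum_congr rfl fun v _ => ?_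
  rw [Finset.sum_ite_eq]

lemma tally_nonneg {f : Fin n → Fin n → ℝ} (hf : ∀ u v, 0 ≤ f u v) (X : Finset (Sym2 (Fin n))) :
    0 ≤ tally f X := by
  refine Finset.sum_nonneg fun u _ => Finset.sum_nonneg fun v _ => ?_
  split_ifs
  · exact hf u v
  · exact le_rfl

lemma tally_le_sum {f : Fin n → Fin n → ℝ} (hf : ∀ u v, 0 ≤ f u v) (X : Finset (Sym2 (Fin n))) :
    tally f X ≤ ∑ u, ∑ v, f u v := by
  refine Finset.sum_le_sum fun u _ => Finset.sum_le_sum fun v _ => ?_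
  split_ifs
  · exact le_rfl
  · exact hf u v

lemma tally_singleton_le {f : Fin n → Fin n → ℝ} {M : ℝ} (hM : 0 ≤ M)
    (hfM : ∀ u v, f u v ≤ M) (e : Sym2 (Fin n)) : tally f {e} ≤ 2 * M := by
  induction e with
  | _ a b =>
    unfold tally
    rw [← Fintype.sum_prod_type'
      (fun u v => if s(u, v) ∈ ({s(a, b)} : Finset (Sym2 (Fin n))) then f u v else 0)]
    rw [← Finset.sum_filter]
    calc _ ≤ ∑ z ∈ ({(a, b), (b, a)} : Finset (Fin n × Fin n)), M := by
          refine le_trans (Finset.sum_le_sum fun z _ => hfM z.1 z.2) ?_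
          refine Finset.sum_le_sum_of_subset_of_nonneg ?_ (fun _ _ _ => hM)
          intro z hz
          simp only [Finset.mem_filter, Finset.mem_singleton, Sym2.eq_iff] at hz
          simp only [Finset.mem_insert, Finset.mem_singleton, Prod.ext_iff]
          exact hz.2
      _ ≤ _ := by
          rw [Finset.sum_const, nsmul_eq_mul]
          refine mul_le_mul_of_nonneg_right ?_ hM
          exact_mod_cast Finset.card_le_two

/-- Exponential tail bound for the total weight of a random set of pairs. -/
lemma bernPr_tally_ge_le {p : ℝ} {U : Finset (Sym2 (Fin n))} (hp0 : 0 ≤ p) (hp1 : p ≤ 1)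
    (f : Fin n → Fin n → ℝ) (M t Y a Z : ℝ) (hM : 0 < M) (ht : 0 ≤ t) (hY0 : 0 ≤ Y)
    (hf0 : ∀ u v, 0 ≤ f u v) (hfM : ∀ u v, f u v ≤ M)
    (hY : Real.exp (t * (2 * M)) - 1 ≤ Y * (2 * M)) (hZ : ∑ u, ∑ v, f u v ≤ Z) :
    bernPr p U (fun X => a ≤ tally f X) ≤ Real.exp (p * Y * Z - t * a) := by
  have e : (fun X : Finset (Sym2 (Fin n)) => a ≤ tally f X) =
      fun X => a ≤ ∑ e ∈ X, tally f {e} :=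
    funext fun X => congrArg (fun r => a ≤ r) (tally_eq_sum f X)
  rw [e]
  refine (bernPr_sum_ge_le hp0 hp1 (fun e => tally f {e}) (2 * M) t Y a (by positivity) ht
    (fun e _ => tally_nonneg hf0 _) (fun e _ => tally_singleton_le hM.le hfM e) hY).trans ?_
  rw [← tally_eq_sum]
  have h := mul_le_mul_of_nonneg_left ((tally_le_sum hf0 U).trans hZ) (mul_nonneg hp0 hY0)
  exact Real.exp_le_exp.2 (by linarith)

/-- The sum of the weights `g v` over the vertices `v` with `s(x, v) ∈ X`. -/
def starSum (X : Finset (Sym2 (Fin n))) (x : Fin n) (g : Fin n → ℝ) : ℝ :=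
  ∑ v, if s(x, v) ∈ X then g v else 0

lemma tally_ite_eq (X : Finset (Sym2 (Fin n))) (x : Fin n) (g : Fin n → ℝ) :
    tally (fun u v => if u = x then g v else 0) X = starSum X x g := by
  unfold tally starSum
  rw [Finset.sum_eq_single x]
  · simp
  · intro u _ hu
    simp [hu]
  · simp

lemma starSum_nonneg {g : Fin n → ℝ} (hg : ∀ v, 0 ≤ g v) (X : Finset (Sym2 (Fin n)))
    (x : Fin n) : 0 ≤ starSum X x g := by
  refine Finset.sum_nonneg fun v _ => ?_
  split_ifs
  · exact hg v
  · exact le_rfl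

lemma tally_union_le {f : Fin n → Fin n → ℝ} (hf : ∀ u v, 0 ≤ f u v)
    (X Y : Finset (Sym2 (Fin n))) : tally f (X ∪ Y) ≤ tally f X + tally f Y := by
  unfold tally
  simp_rw [← Finset.sum_add_distrib]
  refine Finset.sum_le_sum fun u _ => Finset.sum_le_sum fun v _ => ?_
  have := hf u v
  by_cases h1 : s(u, v) ∈ X <;> by_cases h2 : s(u, v) ∈ Y <;> simp [h1, h2, this]

lemma exp_le_of_le_one {x : ℝ} (hx0 : 0 ≤ x) (hx : x ≤ 1) : Real.exp x - 1 ≤ x + x ^ 2 := by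
  have h := Real.abs_exp_sub_one_sub_id_le (x := x) (by rw [abs_of_nonneg hx0]; exact hx)
  have := (abs_le.1 h).2
  linarith

section BadEvents

variable {p : ℝ} {U : Finset (Sym2 (Fin n))}

lemma bernPr_pair_discrepancy_le (hp0 : 0 ≤ p) (hp1 : p ≤ 1) {δ τ L : ℝ} (hτ : 0 ≤ τ)
    (hτ1 : 2 * τ ≤ 1) (hL : δ * τ ^ 2 = L) (hpn : p * n ≤ 2 * δ) (S T : Finset (Fin n)) :
    bernPr p U (fun X => p * S.card * T.card + 20 * δ * τ * (S.card + T.card) ≤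
        tally (fun u v => if u ∈ S ∧ v ∈ T then 1 else 0) X) ≤
      Real.exp (-(18 * L * (S.card + T.card))) := by
  have hY : Real.exp (τ * (2 * 1)) - 1 ≤ τ * (1 + 2 * τ) * (2 * 1) := by
    have := exp_le_of_le_one (x := τ * (2 * 1)) (by linarith) (by linarith)
    linarith
  have hZ : ∑ u : Fin n, ∑ v : Fin n, (if u ∈ S ∧ v ∈ T then (1 : ℝ) else 0) ≤
      S.card * T.card := by
    refine le_of_eq ?_
    rw [← Finset.sum_product', Finset.sum_boole, ← Nat.cast_mul, ← Finset.card_product]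
    congr 2
    ext z
    simp
  refine (bernPr_tally_ge_le hp0 hp1 _ 1 τ _ _ _ one_pos hτ (by positivity)
    (fun u v => by split_ifs <;> norm_num) (fun u v => by split_ifs <;> norm_num) hY hZ).trans ?_
  rw [Real.exp_le_exp]
  have hs : (S.card : ℝ) ≤ n := by exact_mod_cast card_finset_fin_le S
  have ht : (T.card : ℝ) ≤ n := by exact_mod_cast card_finset_fin_le T
  have hs0 : (0 : ℝ) ≤ S.card := Nat.cast_nonneg _
  have ht0 : (0 : ℝ) ≤ T.card := Nat.cast_nonneg _
  generalize (S.card : ℝ) = s at *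
  generalize (T.card : ℝ) = t at *
  have h1 : 2 * (s * t) ≤ n * (s + t) := by nlinarith
  have h2 : p * (s * t) ≤ δ * (s + t) := by
    have := mul_le_mul_of_nonneg_left h1 hp0
    have := mul_le_mul_of_nonneg_right hpn (add_nonneg hs0 ht0)
    nlinarith
  have h3 := mul_le_mul_of_nonneg_right h2 (sq_nonneg τ)
  rw [← hL]
  nlinarith

lemma sum_exp_neg_card_le (hn : 0 < n) :
    ∑ S : Finset (Fin n), Real.exp (-(Real.log n * S.card)) ≤ 3 := by
  have hn' : (0 : ℝ) < n := by exact_mod_cast hn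
  have h : ∀ S : Finset (Fin n), Real.exp (-(Real.log n * S.card)) =
      ∏ _i ∈ S, (n : ℝ)⁻¹ := by
    intro S
    rw [Finset.prod_const, Real.exp_neg, mul_comm, Real.exp_nat_mul, Real.exp_log hn', inv_pow]
  simp_rw [h]
  rw [← Finset.powerset_univ, ← Finset.prod_add_one]
  rw [Finset.prod_const, Finset.card_univ, Fintype.card_fin]
  calc ((n : ℝ)⁻¹ + 1) ^ n ≤ Real.exp ((n : ℝ)⁻¹) ^ n :=
        pow_le_pow_left₀ (by positivity) (Real.add_one_le_exp _) _
    _ = Real.exp 1 := by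
        rw [← Real.exp_nat_mul, mul_inv_cancel₀ hn'.ne']
    _ ≤ 3 := by linarith [Real.exp_one_lt_d9]

lemma bernPr_discrepancy_le (hn : 0 < n) (hp0 : 0 ≤ p) (hp1 : p ≤ 1) {δ τ : ℝ} (hτ : 0 ≤ τ)
    (hτ1 : 2 * τ ≤ 1) (hL : δ * τ ^ 2 = Real.log n) (hpn : p * n ≤ 2 * δ) :
    bernPr p U (fun X => ∃ S T : Finset (Fin n), S.Nonempty ∧ T.Nonempty ∧
      p * S.card * T.card + 20 * δ * τ * (S.card + T.card) ≤
        tally (fun u v => if u ∈ S ∧ v ∈ T then 1 else 0) X) ≤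
      9 * Real.exp (-(11 * Real.log n)) := by
  have hl : 0 ≤ Real.log n := Real.log_natCast_nonneg n
  have h : ∀ z ∈ (Finset.univ : Finset (Finset (Fin n) × Finset (Fin n))),
      bernPr p U (fun X => z.1.Nonempty ∧ z.2.Nonempty ∧
      p * z.1.card * z.2.card + 20 * δ * τ * (z.1.card + z.2.card) ≤
        tally (fun u v => if u ∈ z.1 ∧ v ∈ z.2 then 1 else 0) X) ≤
      Real.exp (-(11 * Real.log n)) * (Real.exp (-(Real.log n * z.1.card)) *
        Real.exp (-(Real.log n * z.2.card))) := by
    intro z _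
    by_cases hz : z.1.Nonempty ∧ z.2.Nonempty
    · refine (bernPr_mono hp0 hp1 fun X _ hX => hX.2.2).trans
        ((bernPr_pair_discrepancy_le hp0 hp1 hτ hτ1 hL hpn z.1 z.2).trans ?_)
      rw [← Real.exp_add, ← Real.exp_add, Real.exp_le_exp]
      have h1 : (1 : ℝ) ≤ z.1.card := by exact_mod_cast hz.1.card_pos
      have h2 : (1 : ℝ) ≤ z.2.card := by exact_mod_cast hz.2.card_pos
      nlinarith
    · refine le_trans (bernEx_mono (g := fun _ => 0) hp0 hp1 fun X _ => ?_) ?_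
      · rw [if_neg]
        exact fun hX => hz ⟨hX.1, hX.2.1⟩
      · rw [bernEx_const]
        positivity
  refine le_trans (bernPr_mono hp0 hp1 fun X _ hX => ?_)
    ((bernPr_exists_le hp0 hp1 _ _).trans ((Finset.sum_le_sum h).trans ?_))
  · obtain ⟨S, T, hX⟩ := hX
    exact ⟨(S, T), Finset.mem_univ _, hX⟩
  · rw [← Finset.mul_sum, Fintype.sum_prod_type' (fun S T : Finset (Fin n) =>
      Real.exp (-(Real.log n * S.card)) * Real.exp (-(Real.log n * T.card))),
      ← Finset.sum_mul_sum, mul_comm]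
    have h3 := sum_exp_neg_card_le hn
    have h0 : 0 ≤ ∑ S : Finset (Fin n), Real.exp (-(Real.log n * S.card)) :=
      Finset.sum_nonneg fun _ _ => (Real.exp_pos _).le
    refine mul_le_mul_of_nonneg_right ?_ (Real.exp_pos _).le
    nlinarith

lemma bernPr_degree_le (hp0 : 0 ≤ p) (hp1 : p ≤ 1) {δ τ L : ℝ} (hτ : 0 ≤ τ)
    (hτ1 : 2 * τ ≤ 1) (hL : δ * τ ^ 2 = L) (hpn : p * n ≤ δ + 1) (x : Fin n) :
    bernPr p U (fun X => δ * (1 + 20 * τ) ≤ starSum X x fun _ => 1) ≤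
      Real.exp (1 - 18 * L) := by
  have hY : Real.exp (τ * (2 * 1)) - 1 ≤ τ * (1 + 2 * τ) * (2 * 1) := by
    have := exp_le_of_le_one (x := τ * (2 * 1)) (by linarith) (by linarith)
    linarith
  have hZ : ∑ u : Fin n, ∑ _v : Fin n, (if u = x then (1 : ℝ) else 0) ≤ n := by
    rw [Finset.sum_comm]
    simp
  have h := bernPr_tally_ge_le (U := U) hp0 hp1 (fun u _ => if u = x then 1 else 0) 1 τ _
    (δ * (1 + 20 * τ)) _ one_pos hτ (by positivity)
    (fun u v => by split_ifs <;> norm_num) (fun u v => by split_ifs <;> norm_num) hY hZ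
  simp_rw [tally_ite_eq _ x (fun _ => 1)] at h
  refine h.trans ?_
  rw [Real.exp_le_exp, ← hL]
  have h1 := mul_le_mul_of_nonneg_left hpn (show 0 ≤ τ * (1 + 2 * τ) by positivity)
  nlinarith

variable {K : SimpleGraph (Fin n)} {d : ℕ}

lemma bernPr_codegree_le (hK : IsRegularGraph K d) (hp0 : 0 ≤ p) (hp1 : p ≤ 1) {L : ℝ}
    (hL : 0 ≤ L) (hpd : p * d * Real.exp (L / 2) ≤ 2) (x w : Fin n) :
    bernPr p U (fun X => 60 ≤ starSum X x fun v => if K.Adj w v then 1 else 0) ≤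
      Real.exp (1 - 15 * L) := by
  have hY : Real.exp (L / 4 * (2 * 1)) - 1 ≤ Real.exp (L / 2) / 2 * (2 * 1) := by
    rw [show L / 4 * (2 * 1) = L / 2 by ring]
    linarith
  have hZ : ∑ u : Fin n, ∑ v : Fin n,
      (if u = x then (if K.Adj w v then (1 : ℝ) else 0) else 0) ≤ d := by
    rw [Finset.sum_comm]
    simp_rw [Finset.sum_ite_eq', Finset.mem_univ, if_true]
    rw [isRegularGraph_sum_ite hK, mul_one]
  have h := bernPr_tally_ge_le (U := U) hp0 hp1
    (fun u v => if u = x then (if K.Adj w v then 1 else 0) else 0) 1 (L / 4) _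
    60 _ one_pos (by positivity) (by positivity)
    (fun u v => by split_ifs <;> norm_num) (fun u v => by split_ifs <;> norm_num) hY hZ
  simp_rw [tally_ite_eq _ x (fun v => if K.Adj w v then 1 else 0)] at h
  refine h.trans ?_
  rw [Real.exp_le_exp]
  nlinarith

lemma bernPr_second_neighbourhood_le (hK : IsRegularGraph K d) (hp0 : 0 ≤ p) (hp1 : p ≤ 1)
    {δ L B : ℝ} (hδ : 1 ≤ δ) (hB : 0 < B)
    (hU : ∀ u v, s(u, v) ∈ U → ¬ K.Adj u v) (x : Fin n) :
    bernPr p U (fun X =>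
      (∀ w, starSum X x (fun v => if K.Adj w v then 1 else 0) ≤ B) ∧
      p * n * d * starSum X x (fun _ => 1) * (1 + 1 / δ) + 30 * B * L * δ +
          B * starSum X x (fun _ => 1) ≤
        tally (fun u _ => starSum X x (fun v => if K.Adj u v then 1 else 0)) X) ≤
      Real.exp (-(15 * L)) := by
  set U₁ := U.filter (fun e => x ∈ e) with hU₁
  set U₂ := U.filter (fun e => x ∉ e) with hU₂
  have hUU : U = U₁ ∪ U₂ := (Finset.filter_union_filter_not_eq _ _).symm
  have hd : Disjoint U₁ U₂ := Finset.disjoint_filter_filter_not _ _ _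
  unfold bernPr
  rw [hUU, bernEx_union hd]
  refine le_trans (bernEx_mono (g := fun _ => Real.exp (-(15 * L))) hp0 hp1 fun X hX => ?_)
    (bernEx_const _).le
  have hstar : ∀ Y ⊆ U₂, ∀ g, starSum (X ∪ Y) x g = starSum X x g := by
    intro Y hY g
    refine Finset.sum_congr rfl fun v _ => ?_
    have : s(x, v) ∉ Y := fun h => (Finset.mem_filter.1 (hY h)).2 (Sym2.mem_mk_left x v)
    simp [this]
  set b : Fin n → ℝ := fun w => starSum X x (fun v => if K.Adj w v then 1 else 0) with hb
  set s := starSum X x (fun _ => 1) with hs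
  have hb0 : ∀ w, 0 ≤ b w := fun w =>
    starSum_nonneg (fun v => by split_ifs <;> norm_num) X x
  have hs0 : 0 ≤ s := starSum_nonneg (fun v => by norm_num) X x
  by_cases hbB : ∀ w, b w ≤ B
  · have hbx : b x = 0 := by
      refine Finset.sum_eq_zero fun v _ => ?_
      by_cases h : s(x, v) ∈ X
      · rw [if_pos h]
        exact if_neg (hU _ _ (Finset.mem_filter.1 (hX h)).1)
      · rw [if_neg h]
    have hXs : tally (fun u _ => b u) X ≤ B * s := by
      unfold tally
      rw [hs, starSum, Finset.mul_sum]
      refine Finset.sum_le_sum fun u _ => ?_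
      rw [Finset.sum_eq_single x]
      · rw [Sym2.eq_swap]
        split_ifs
        · simpa using hbB u
        · simp
      · intro v _ hv
        split_ifs with h
        · have h2 := (Finset.mem_filter.1 (hX h)).2
          rw [Sym2.mem_iff] at h2
          rcases h2 with h2 | h2
          · subst h2
            exact hbx
          · exact absurd h2.symm hv
        · rfl
      · simp
    have hsum : ∑ u, ∑ _v : Fin n, b u ≤ n * (d * s) := by
      have h1 : ∑ u, b u = d * s := by
        simp only [hb, hs, starSum]
        rw [Finset.sum_comm, Finset.mul_sum]
        refine Finset.sum_congr rfl fun v _ => ?_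
        split_ifs with h
        · simp_rw [K.adj_comm _ v]
          exact isRegularGraph_sum_ite hK v 1
        · simp
      rw [← h1, Finset.mul_sum]
      simp
    have hY : Real.exp (1 / (2 * B * δ) * (2 * B)) - 1 ≤
        1 / (2 * B * δ) * (1 + 1 / δ) * (2 * B) := by
      have e : 1 / (2 * B * δ) * (2 * B) = 1 / δ := by field_simp
      have e2 : 1 / (2 * B * δ) * (1 + 1 / δ) * (2 * B) = 1 / δ + (1 / δ) ^ 2 := by field_simp
      rw [e, e2]
      exact exp_le_of_le_one (by positivity) (by rw [div_le_one (by linarith)]; exact hδ)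
    have h := bernPr_tally_ge_le (U := U₂) hp0 hp1 (fun u _ => b u) B (1 / (2 * B * δ)) _
      (p * n * d * s * (1 + 1 / δ) + 30 * B * L * δ) _ hB (by positivity) (by positivity)
      (fun u _ => hb0 u) (fun u _ => hbB u) hY hsum
    refine le_trans (le_trans (bernPr_mono hp0 hp1 fun Y hYU hP => ?_) h) ?_
    · have h1 := hP.2
      simp only [hstar Y hYU] at h1
      have h2 := tally_union_le (fun u _ => hb0 u) X Y
      linarith
    · rw [Real.exp_le_exp]
      refine le_of_eq ?_
      field_simp
      ring
  · refine le_trans (bernEx_mono (g := fun _ => 0) hp0 hp1 fun Y hYU => ?_) ?_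
    · rw [if_neg]
      intro hP
      refine hbB fun w => ?_
      have := hP.1 w
      rwa [hstar Y hYU] at this
    · rw [bernEx_const]
      positivity

end BadEvents

lemma error_bound {N D p δ ρ L : ℝ} (hN : 0 < N) (hD : 0 ≤ D) (hp : 0 ≤ p) (hδ : 1 ≤ δ)
    (hρ : 0 < ρ) (hρ1 : ρ ≤ 1 / 10000) (hL : δ * ρ ^ 4 = L) (hL1 : 1 ≤ L) (hpN : p * N ≤ δ + 1)
    {ℓ a b : ℕ} (hab : ℓ = a + b + 1) (hℓ : ℓ ≤ 10 * L) :
    (D * (δ + 2000)) ^ (a + b) * D * (p * (1 + 2000 * ρ ^ 2) ^ 2 + 81 * (44 * ρ * δ) / N) ≤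
      (1 + 4000 * ρ) * D ^ ℓ * δ ^ ℓ / N := by
  have hρ2 : ρ ^ 2 ≤ 1 / 10000 * ρ := by nlinarith
  have hρ4 : ρ ^ 4 ≤ 1 / 10 ^ 12 * ρ := by
    have h : ρ ^ 3 ≤ (1 / 10000) ^ 3 := pow_le_pow_left₀ hρ.le hρ1 3
    have : ρ ^ 4 = ρ ^ 3 * ρ := by ring
    rw [this]
    exact mul_le_mul_of_nonneg_right (by norm_num at h ⊢; exact h) hρ.le
  have hq : p * (1 + 2000 * ρ ^ 2) ^ 2 + 81 * (44 * ρ * δ) / N ≤ δ / N * (1 + 3566 * ρ) := by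
    have h1 : p ≤ (δ + 1) / N := by rw [le_div_iff₀ hN]; exact hpN
    have h2 : 1 ≤ δ * (1 / 10 ^ 12 * ρ) := by
      have := mul_le_mul_of_nonneg_left hρ4 (by linarith : (0 : ℝ) ≤ δ)
      linarith
    have h3 : (1 + 2000 * ρ ^ 2) ^ 2 ≤ 1 + ρ := by nlinarith [sq_nonneg ρ]
    have h4 : p * (1 + 2000 * ρ ^ 2) ^ 2 ≤ (δ + 1) / N * (1 + ρ) :=
      mul_le_mul h1 h3 (by positivity) (by positivity)
    have h5 : (δ + 1) * (1 + ρ) ≤ δ * (1 + 2 * ρ) := by nlinarith [mul_pos hρ hρ]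
    have h6 := div_le_div_of_nonneg_right h5 hN.le
    calc _ ≤ (δ + 1) / N * (1 + ρ) + 81 * (44 * ρ * δ) / N := by linarith
      _ = (δ + 1) * (1 + ρ) / N + 81 * (44 * ρ * δ) / N := by ring
      _ ≤ δ * (1 + 2 * ρ) / N + 81 * (44 * ρ * δ) / N := by linarith
      _ = δ / N * (1 + 3566 * ρ) := by ring
  have hpow : (δ + 2000) ^ (a + b) ≤ δ ^ (a + b) * (1 + ρ) := by
    have h1 : (δ + 2000) ^ (a + b) = δ ^ (a + b) * (1 + 2000 / δ) ^ (a + b) := by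
      rw [← mul_pow]
      congr 1
      field_simp
    rw [h1]
    refine mul_le_mul_of_nonneg_left ?_ (by positivity)
    have h2 : 2000 / δ * ℓ ≤ 20000 * ρ ^ 4 := by
      have : ρ ^ 4 = L / δ := by rw [← hL]; field_simp
      rw [this, div_mul_eq_mul_div, mul_div_assoc']
      exact div_le_div_of_nonneg_right (by linarith) (by linarith)
    have h3 : ((a + b : ℕ) : ℝ) ≤ ℓ := by exact_mod_cast (by omega : a + b ≤ ℓ)
    calc (1 + 2000 / δ) ^ (a + b) ≤ Real.exp (2000 / δ) ^ (a + b) :=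
          pow_le_pow_left₀ (by positivity) (by linarith [Real.add_one_le_exp (2000 / δ)]) _
      _ = Real.exp ((a + b : ℕ) * (2000 / δ)) := by rw [Real.exp_nat_mul]
      _ ≤ Real.exp (20000 * ρ ^ 4) := by
          rw [Real.exp_le_exp]
          have := mul_le_mul_of_nonneg_right h3 (by positivity : 0 ≤ 2000 / δ)
          linarith
      _ ≤ 1 + ρ := by
          have h5 : 20000 * ρ ^ 4 ≤ 1 / 10 ^ 6 * ρ := by linarith
          have h4 := exp_le_of_le_one (x := 20000 * ρ ^ 4) (by positivity) (by linarith)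
          have h6 : (20000 * ρ ^ 4) ^ 2 ≤ 20000 * ρ ^ 4 := by
            rw [sq]
            exact mul_le_of_le_one_left (by positivity) (by linarith)
          linarith
  rw [mul_pow]
  calc D ^ (a + b) * (δ + 2000) ^ (a + b) * D *
        (p * (1 + 2000 * ρ ^ 2) ^ 2 + 81 * (44 * ρ * δ) / N)
      ≤ D ^ (a + b) * (δ ^ (a + b) * (1 + ρ)) * D * (δ / N * (1 + 3566 * ρ)) := by
        gcongr
    _ = (1 + ρ) * (1 + 3566 * ρ) * (D ^ ℓ * δ ^ ℓ / N) := by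
        subst hab
        rw [pow_succ, pow_succ]
        ring
    _ ≤ (1 + 4000 * ρ) * (D ^ ℓ * δ ^ ℓ / N) := by
        refine mul_le_mul_of_nonneg_right ?_ (by positivity)
        nlinarith
    _ = _ := by ring

section Typical

variable {A K : SimpleGraph (Fin n)} {d : ℕ} {X : Finset (Sym2 (Fin n))}

lemma wNbrSum_eq_starSum (hA : ∀ u v, A.Adj u v ↔ s(u, v) ∈ X) (g : Fin n → ℝ) (x : Fin n) :
    wNbrSum A g x = starSum X x g := by
  unfold wNbrSum starSum
  simp_rw [hA]

lemma pairCount_eq_tally (hA : ∀ u v, A.Adj u v ↔ s(u, v) ∈ X) (S T : Finset (Fin n)) :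
    pairCount A S T = tally (fun u v => if u ∈ S ∧ v ∈ T then 1 else 0) X := by
  unfold pairCount tally
  rw [← Finset.sum_product', ← Finset.sum_product', Finset.sum_boole]
  simp_rw [← ite_and]
  rw [Finset.sum_boole]
  congr 2
  ext z
  simp [hA, and_comm]

lemma wNbrSum_wNbrSum_eq_tally (hA : ∀ u v, A.Adj u v ↔ s(u, v) ∈ X) (x : Fin n) :
    wNbrSum A (wNbrSum K fun v => starSum X v fun _ => 1) x =
      tally (fun u _ => starSum X x fun v => if K.Adj u v then 1 else 0) X := by
  rw [wNbrSum_eq_starSum hA]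
  have h : ∀ u : Fin n, (∑ v : Fin n, if s(u, v) ∈ X then
      (starSum X x fun v => if K.Adj u v then 1 else 0) else 0) =
      ∑ v, if s(x, v) ∈ X then (if K.Adj v u then starSum X u fun _ => 1 else 0) else 0 := by
    intro u
    simp only [starSum]
    rw [← Finset.sum_filter, Finset.sum_const, nsmul_eq_mul, Finset.mul_sum]
    refine Finset.sum_congr rfl fun v _ => ?_
    rw [K.adj_comm u v]
    split_ifs <;> simp
  unfold tally
  simp_rw [h]
  rw [Finset.sum_comm]
  unfold starSum wNbrSum
  refine Finset.sum_congr rfl fun v _ => ?_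
  split_ifs <;> simp

lemma wNbrSum_add_const (hK : IsRegularGraph K d) (g : Fin n → ℝ) (c : ℝ) (x : Fin n) :
    wNbrSum A (wNbrSum K fun v => g v + c) x =
      wNbrSum A (wNbrSum K g) x + d * c * wNbrSum A (fun _ => 1) x := by
  have h : ∀ v, wNbrSum K (fun v => g v + c) v = wNbrSum K g v + d * c := by
    intro v
    rw [← isRegularGraph_sum_ite hK v c]
    unfold wNbrSum
    rw [← Finset.sum_add_distrib]
    refine Finset.sum_congr rfl fun u _ => ?_
    split_ifs <;> simp
  have h2 : wNbrSum K (fun v => g v + c) = fun v => wNbrSum K g v + d * c := funext h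
  rw [h2]
  unfold wNbrSum
  rw [Finset.mul_sum, ← Finset.sum_add_distrib]
  refine Finset.sum_congr rfl fun u _ => ?_
  split_ifs <;> simp

lemma pow_le_one_div_sqrt (hn : 0 < n) {k : ℝ} (hk0 : 0 ≤ k) (hk : k ≤ Real.exp (-3)) {a : ℕ}
    (ha : Real.log n ≤ 6 * (a : ℝ)) : k ^ a ≤ 1 / √n := by
  have hn' : (0 : ℝ) < n := by exact_mod_cast hn
  have e : √(n : ℝ) = Real.exp (Real.log n / 2) := by
    rw [← Real.exp_log hn', Real.log_exp, Real.exp_half]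
  rw [e, one_div, ← Real.exp_neg]
  refine (pow_le_pow_left₀ hk0 hk a).trans ?_
  rw [← Real.exp_nat_mul, Real.exp_le_exp]
  linarith

lemma altWalks_le_of_typical (hn : 0 < n) (hK : IsRegularGraph K d)
    (hA : ∀ u v, A.Adj u v ↔ s(u, v) ∈ X) {p δ ρ : ℝ} (hp : 0 ≤ p) (hδ : 1 ≤ δ) (hρ : 0 < ρ)
    (hρ1 : ρ ≤ 1 / 10000) (hL : δ * ρ ^ 4 = Real.log n) (hL3 : 3 ≤ Real.log n)
    (hpn : p * n ≤ δ + 1) (hdL : Real.log n ≤ d)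
    (hdisc : ∀ S T : Finset (Fin n), S.Nonempty → T.Nonempty →
      tally (fun u v => if u ∈ S ∧ v ∈ T then 1 else 0) X ≤
        p * S.card * T.card + 20 * δ * ρ ^ 2 * (S.card + T.card))
    (hdeg : ∀ x, (starSum X x fun _ => 1) ≤ δ * (1 + 20 * ρ ^ 2))
    (hsec : ∀ x, tally (fun u _ => starSum X x fun v => if K.Adj u v then 1 else 0) X ≤
      p * n * d * starSum X x (fun _ => 1) * (1 + 1 / δ) + 30 * 60 * Real.log n * δ +
          60 * starSum X x (fun _ => 1))
    (ℓ : ℕ) (hℓ : Real.log n ≤ ℓ) (hℓ2 : ℓ ≤ 10 * Real.log n) (x y : Fin n) :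
    (altWalks (2 * ℓ) A K y x : ℝ) ≤ (1 + 4000 * ρ) * d ^ ℓ * δ ^ ℓ / n := by
  have hn' : (0 : ℝ) < n := by exact_mod_cast hn
  set L := Real.log n with hLdef
  have hd1 : (1 : ℝ) ≤ d := by linarith
  have hρ2 : ρ ^ 2 ≤ 1 / 10000 * ρ := by nlinarith
  have hδρ : 1 ≤ δ * ρ ^ 2 := by
    have h : ρ ^ 4 ≤ ρ ^ 2 := by nlinarith [sq_nonneg ρ]
    have := mul_le_mul_of_nonneg_left h (by linarith : (0 : ℝ) ≤ δ)
    linarith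
  have hs0 : ∀ v, 0 ≤ starSum X v fun _ => (1 : ℝ) := fun v =>
    starSum_nonneg (fun _ => zero_le_one) X v
  have hpair : ∀ S T : Finset (Fin n), pairCount A S T ≤
      p * S.card * T.card + 20 * δ * ρ ^ 2 * (S.card + T.card) := by
    intro S T
    have hs : (0 : ℝ) ≤ S.card := Nat.cast_nonneg _
    have ht : (0 : ℝ) ≤ T.card := Nat.cast_nonneg _
    rcases S.eq_empty_or_nonempty with rfl | hS
    · unfold pairCount
      rw [Finset.sum_empty]
      positivity
    rcases T.eq_empty_or_nonempty with rfl | hT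
    · unfold pairCount
      simp only [Finset.sum_empty, Finset.sum_const_zero]
      positivity
    rw [pairCount_eq_tally hA]
    exact hdisc S T hS hT
  have hpairdeg : ∀ x, pairCount A {x} Finset.univ ≤ δ * (1 + 20 * ρ ^ 2) := by
    intro x
    refine le_trans (le_of_eq ?_) (hdeg x)
    rw [← wNbrSum_eq_starSum hA]
    unfold pairCount wNbrSum
    rw [Finset.sum_singleton]
  have hbil : ∀ u w : Fin n → ℕ, ((∑ x, u x * nbrSum A w x : ℕ) : ℝ) ≤
      p * (∑ x, (u x : ℝ)) * (∑ x, (w x : ℝ)) +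
        44 * ρ * δ * (√(∑ x, (u x : ℝ) ^ 2) * √(∑ x, (w x : ℝ) ^ 2)) := by
    intro u w
    refine (bilinear_le_of_discrepancy A p (20 * δ * ρ ^ 2) (δ * (1 + 20 * ρ ^ 2)) (1 / ρ) hp
      (by positivity) (by positivity) (by positivity) hpairdeg hpair u w).trans ?_
    have e : 2 * (20 * δ * ρ ^ 2) * (1 / ρ) + 2 * (δ * (1 + 20 * ρ ^ 2)) / (1 / ρ) =
        δ * ρ * (42 + 40 * ρ ^ 2) := by
      field_simp
      ring
    rw [e]
    refine add_le_add_right (mul_le_mul_of_nonneg_right ?_ (by positivity)) _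
    have : δ * ρ * (42 + 40 * ρ ^ 2) ≤ δ * ρ * 44 :=
      mul_le_mul_of_nonneg_left (by linarith) (by positivity)
    linarith
  obtain ⟨a, b, hab, haL, hbL⟩ : ∃ a b : ℕ, ℓ = a + b + 1 ∧ L ≤ 6 * (a : ℝ) ∧ L ≤ 6 * (b : ℝ) := by
    have h3 : 3 ≤ ℓ := by exact_mod_cast hL3.trans hℓ
    have h1 : ℓ ≤ 6 * ((ℓ - 1) / 2) := by omega
    have h2 : ℓ ≤ 6 * (ℓ - 1 - (ℓ - 1) / 2) := by omega
    refine ⟨(ℓ - 1) / 2, ℓ - 1 - (ℓ - 1) / 2, by omega, hℓ.trans ?_, hℓ.trans ?_⟩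
    · exact_mod_cast h1
    · exact_mod_cast h2
  have hk3 : 44 * ρ ≤ Real.exp (-3) := by
    have h : Real.exp 3 ≤ 27 := by
      rw [show (3 : ℝ) = (3 : ℕ) * 1 by norm_num, Real.exp_nat_mul]
      calc Real.exp 1 ^ 3 ≤ 3 ^ 3 :=
            pow_le_pow_left₀ (Real.exp_pos _).le (by linarith [Real.exp_one_lt_d9]) 3
        _ = 27 := by norm_num
    have h2 : (27 : ℝ)⁻¹ ≤ Real.exp (-3) := by
      rw [Real.exp_neg]
      exact inv_anti₀ (Real.exp_pos _) h
    norm_num at h2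
    linarith
  have hmain := altWalks_le hn hK (fun v => (starSum X v fun _ => 1) + 1800) p (44 * ρ * δ)
    (44 * ρ) (d * (δ + 2000)) (1 + 2000 * ρ ^ 2) hp (by positivity) (by positivity)
    (by linarith) (by positivity) (by linarith [sq_nonneg ρ]) hbil
    (by nlinarith [mul_nonneg hρ.le (by linarith : (0 : ℝ) ≤ d)])
    (by
      have h1 : p * n * (1 + 2000 * ρ ^ 2) ≤ (δ + 1) * 2 :=
        mul_le_mul hpn (by linarith) (by positivity) (by positivity)
      have h2 := mul_le_mul_of_nonneg_left h1 (by linarith : (0 : ℝ) ≤ d)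
      nlinarith)
    (by
      intro x
      rw [wNbrSum_add_const hK, wNbrSum_wNbrSum_eq_tally hA, wNbrSum_eq_starSum hA]
      have h1 := hsec x
      have h2 := hs0 x
      generalize (starSum X x fun _ => 1) = s at *
      have h3 : p * n * (1 + 1 / δ) ≤ δ + 3 := by
        have h4 : (δ + 1) * (1 + 1 / δ) = δ + 2 + 1 / δ := by field_simp; ring
        have h5 : 1 / δ ≤ 1 := by rw [div_le_one (by linarith)]; exact hδ
        have h6 := mul_le_mul_of_nonneg_right hpn (by positivity : 0 ≤ 1 + 1 / δ)
        linarith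
      have h4 := mul_le_mul_of_nonneg_right h3 (mul_nonneg (by linarith : (0 : ℝ) ≤ d) h2)
      have h5 : L * δ ≤ d * δ := mul_le_mul_of_nonneg_right hdL (by linarith)
      have h6 : s ≤ d * s := by nlinarith
      nlinarith)
    (by
      intro x
      rw [wNbrSum_eq_starSum hA]
      linarith)
    (by
      intro x
      have h1 := hdeg x
      have h2 : (starSum X x fun _ => 1) + 1800 ≤ (1 + 2000 * ρ ^ 2) * (δ + 2000) := by
        nlinarith [sq_nonneg ρ]
      have h3 := mul_le_mul_of_nonneg_left h2 (by linarith : (0 : ℝ) ≤ d)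
      linarith)
    a b (pow_le_one_div_sqrt hn (by positivity) hk3 haL)
    (pow_le_one_div_sqrt hn (by positivity) hk3 hbL) x y
  rw [← hab] at hmain
  exact hmain.trans (error_bound hn' (Nat.cast_nonneg d) hp hδ hρ hρ1 hL
    (by linarith) hpn hab hℓ2)

end Typical

lemma bernPr_atypical_le {p : ℝ} {K : SimpleGraph (Fin n)} {d : ℕ} {U : Finset (Sym2 (Fin n))}
    (hn : 0 < n) (hK : IsRegularGraph K d) (hp0 : 0 ≤ p) (hp1 : p ≤ 1) {δ τ : ℝ} (hδ : 1 ≤ δ)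
    (hτ : 0 ≤ τ) (hτ1 : 2 * τ ≤ 1) (hL : δ * τ ^ 2 = Real.log n) (hpn : p * n ≤ δ + 1)
    (hpd : p * d * Real.exp (Real.log n / 2) ≤ 2)
    (hU : ∀ u v, s(u, v) ∈ U → ¬ K.Adj u v) :
    bernPr p U (fun X =>
      (∃ S T : Finset (Fin n), S.Nonempty ∧ T.Nonempty ∧
        p * S.card * T.card + 20 * δ * τ * (S.card + T.card) ≤
          tally (fun u v => if u ∈ S ∧ v ∈ T then 1 else 0) X) ∨
      (∃ x, δ * (1 + 20 * τ) ≤ starSum X x fun _ => 1) ∨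
      (∃ z : Fin n × Fin n, 60 ≤ starSum X z.1 fun v => if K.Adj z.2 v then 1 else 0) ∨
      ∃ x, (∀ w, starSum X x (fun v => if K.Adj w v then 1 else 0) ≤ 60) ∧
        p * n * d * starSum X x (fun _ => 1) * (1 + 1 / δ) + 30 * 60 * Real.log n * δ +
            60 * starSum X x (fun _ => 1) ≤
          tally (fun u _ => starSum X x (fun v => if K.Adj u v then 1 else 0)) X) ≤
      20 * Real.exp (-(11 * Real.log n)) := by
  have hn' : (0 : ℝ) < n := by exact_mod_cast hn
  have hl : 0 ≤ Real.log n := Real.log_natCast_nonneg n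
  have hnl : (n : ℝ) = Real.exp (Real.log n) := (Real.exp_log hn').symm
  have he : Real.exp 1 ≤ 3 := by linarith [Real.exp_one_lt_d9]
  have h1 := bernPr_discrepancy_le (U := U) hn hp0 hp1 hτ hτ1 hL (by linarith)
  have h2 : bernPr p U (fun X => ∃ x, δ * (1 + 20 * τ) ≤ starSum X x fun _ => 1) ≤
      3 * Real.exp (-(11 * Real.log n)) := by
    have h := bernPr_exists_le (U := U) hp0 hp1 Finset.univ
      (fun x X => δ * (1 + 20 * τ) ≤ starSum X x fun _ => 1)
    simp only [Finset.mem_univ, true_and] at h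
    refine (h.trans (Finset.sum_le_sum fun x _ =>
      bernPr_degree_le hp0 hp1 hτ hτ1 hL hpn x)).trans ?_
    rw [Finset.sum_const, nsmul_eq_mul, Finset.card_univ, Fintype.card_fin]
    calc (n : ℝ) * Real.exp (1 - 18 * Real.log n)
        = Real.exp 1 * Real.exp (-(17 * Real.log n)) := by
          nth_rewrite 1 [hnl]
          rw [← Real.exp_add, ← Real.exp_add]
          congr 1
          ring
      _ ≤ 3 * Real.exp (-(11 * Real.log n)) :=
          mul_le_mul he (Real.exp_le_exp.2 (by linarith)) (Real.exp_pos _).le (by norm_num)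
  have h3 : bernPr p U (fun X => ∃ z : Fin n × Fin n,
      60 ≤ starSum X z.1 fun v => if K.Adj z.2 v then 1 else 0) ≤
      3 * Real.exp (-(11 * Real.log n)) := by
    have h := bernPr_exists_le (U := U) hp0 hp1 Finset.univ
      (fun (z : Fin n × Fin n) X => 60 ≤ starSum X z.1 fun v => if K.Adj z.2 v then 1 else 0)
    simp only [Finset.mem_univ, true_and] at h
    refine (h.trans (Finset.sum_le_sum fun z _ =>
      bernPr_codegree_le hK hp0 hp1 hl hpd z.1 z.2)).trans ?_
    rw [Finset.sum_const, nsmul_eq_mul, Finset.card_univ, Fintype.card_prod, Fintype.card_fin]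
    push_cast
    calc (n : ℝ) * n * Real.exp (1 - 15 * Real.log n)
        = Real.exp 1 * Real.exp (-(13 * Real.log n)) := by
          nth_rewrite 1 2 [hnl]
          rw [← Real.exp_add, ← Real.exp_add, ← Real.exp_add]
          congr 1
          ring
      _ ≤ 3 * Real.exp (-(11 * Real.log n)) :=
          mul_le_mul he (Real.exp_le_exp.2 (by linarith)) (Real.exp_pos _).le (by norm_num)
  have h4 : bernPr p U (fun X => ∃ x,
      (∀ w, starSum X x (fun v => if K.Adj w v then 1 else 0) ≤ 60) ∧
        p * n * d * starSum X x (fun _ => 1) * (1 + 1 / δ) + 30 * 60 * Real.log n * δ +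
            60 * starSum X x (fun _ => 1) ≤
          tally (fun u _ => starSum X x (fun v => if K.Adj u v then 1 else 0)) X) ≤
      1 * Real.exp (-(11 * Real.log n)) := by
    have h := bernPr_exists_le (U := U) hp0 hp1 Finset.univ (fun x X =>
      (∀ w, starSum X x (fun v => if K.Adj w v then 1 else 0) ≤ 60) ∧
        p * n * d * starSum X x (fun _ => 1) * (1 + 1 / δ) + 30 * 60 * Real.log n * δ +
            60 * starSum X x (fun _ => 1) ≤
          tally (fun u _ => starSum X x (fun v => if K.Adj u v then 1 else 0)) X)
    simp only [Finset.mem_univ, true_and] at h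
    refine (h.trans (Finset.sum_le_sum fun x _ => bernPr_second_neighbourhood_le hK hp0 hp1 hδ
      (by norm_num) hU x)).trans ?_
    rw [Finset.sum_const, nsmul_eq_mul, Finset.card_univ, Fintype.card_fin]
    nth_rewrite 1 [hnl]
    rw [← Real.exp_add, one_mul, Real.exp_le_exp]
    linarith
  refine (bernPr_or_le hp0 hp1 _ _).trans ?_
  refine (add_le_add h1 ((bernPr_or_le hp0 hp1 _ _).trans
    (add_le_add h2 ((bernPr_or_le hp0 hp1 _ _).trans (add_le_add h3 h4))))).trans ?_
  linarith [Real.exp_pos (-(11 * Real.log n))]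

/-- The pairs of distinct vertices that are not edges of `K`. -/
def compEdges (K : SimpleGraph (Fin n)) : Finset (Sym2 (Fin n)) :=
  Finset.univ.filter fun e => e ∈ Kᶜ.edgeSet

lemma mem_compEdges {K : SimpleGraph (Fin n)} {u v : Fin n} :
    s(u, v) ∈ compEdges K ↔ u ≠ v ∧ ¬ K.Adj u v := by
  simp [compEdges]

/-- The graph obtained from `K` by adding the pairs in `X`. -/
def addEdges (K : SimpleGraph (Fin n)) (X : Finset (Sym2 (Fin n))) : SimpleGraph (Fin n) :=
  K ⊔ SimpleGraph.fromEdgeSet X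

lemma addEdges_sdiff_adj {K : SimpleGraph (Fin n)} {X : Finset (Sym2 (Fin n))}
    (hX : X ⊆ compEdges K) (u v : Fin n) : (addEdges K X \ K).Adj u v ↔ s(u, v) ∈ X := by
  have h := fun h : s(u, v) ∈ X => mem_compEdges.1 (hX h)
  simp only [addEdges, SimpleGraph.sdiff_adj, SimpleGraph.sup_adj, SimpleGraph.fromEdgeSet_adj,
    Finset.mem_coe]
  tauto

lemma ncard_compEdges (K : SimpleGraph (Fin n)) :
    edgeCount K + (compEdges K).card = n.choose 2 := by
  have h : K.edgeSet ∪ (compEdges K : Set (Sym2 (Fin n))) = (⊤ : SimpleGraph (Fin n)).edgeSet := by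
    ext e
    induction e with
    | _ u v =>
      have := K.ne_of_adj (a := u) (b := v)
      simp only [Set.mem_union, Finset.mem_coe, mem_compEdges, SimpleGraph.mem_edgeSet,
        SimpleGraph.top_adj]
      tauto
  have hd : Disjoint K.edgeSet (compEdges K : Set (Sym2 (Fin n))) := by
    rw [Set.disjoint_left]
    intro e
    induction e with
    | _ u v => exact fun h1 h2 => (mem_compEdges.1 h2).2 h1
  have h2 := Set.ncard_union_eq hd (Set.toFinite _) (Set.toFinite _)
  rw [h, Set.ncard_coe_finset, ← SimpleGraph.coe_edgeFinset, Set.ncard_coe_finset,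
    SimpleGraph.card_edgeFinset_top_eq_card_choose_two, Fintype.card_fin] at h2
  exact h2.symm

lemma edgeCount_addEdges {K : SimpleGraph (Fin n)} {X : Finset (Sym2 (Fin n))}
    (hX : X ⊆ compEdges K) : edgeCount (addEdges K X) = edgeCount K + X.card := by
  have h : (addEdges K X).edgeSet = K.edgeSet ∪ (X : Set (Sym2 (Fin n))) := by
    ext e
    induction e with
    | _ u v =>
      have h := fun h : s(u, v) ∈ X => mem_compEdges.1 (hX h)
      simp only [Set.mem_union, Finset.mem_coe, SimpleGraph.mem_edgeSet, addEdges,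
        SimpleGraph.sup_adj, SimpleGraph.fromEdgeSet_adj]
      tauto
  have hd : Disjoint K.edgeSet (X : Set (Sym2 (Fin n))) := by
    rw [Set.disjoint_left]
    intro e
    induction e with
    | _ u v => exact fun h1 h2 => (mem_compEdges.1 (hX h2)).2 h1
  unfold edgeCount
  rw [h, Set.ncard_union_eq hd (Set.toFinite _) (Set.toFinite _), Set.ncard_coe_finset]

lemma sum_supergraphs_eq_bernPr (p : ℝ) (K : SimpleGraph (Fin n))
    (P : SimpleGraph (Fin n) → Prop) :
    ∑ F ∈ Finset.univ.filter (fun F => K ≤ F ∧ P F),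
      p ^ (edgeCount F - edgeCount K) * (1 - p) ^ (n.choose 2 - edgeCount F) =
      bernPr p (compEdges K) fun X => P (addEdges K X) := by
  unfold bernPr bernEx
  simp_rw [mul_ite, mul_one, mul_zero]
  rw [← Finset.sum_filter]
  symm
  refine Finset.sum_nbij' (addEdges K)
    (fun F => Finset.univ.filter fun e => e ∈ (F \ K).edgeSet) ?_ ?_ ?_ ?_ ?_
  · intro X hX
    rw [Finset.mem_filter] at hX ⊢
    exact ⟨Finset.mem_univ _, le_sup_left, hX.2⟩
  · intro F hF
    have hF := (Finset.mem_filter.1 hF).2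
    rw [Finset.mem_filter, Finset.mem_powerset]
    have e : addEdges K (Finset.univ.filter fun e => e ∈ (F \ K).edgeSet) = F := by
      ext u v
      have h1 := @hF.1 u v
      have h2 := F.ne_of_adj (a := u) (b := v)
      simp only [addEdges, SimpleGraph.sup_adj, SimpleGraph.fromEdgeSet_adj, Finset.mem_coe,
        Finset.mem_filter, Finset.mem_univ, true_and, SimpleGraph.mem_edgeSet,
        SimpleGraph.sdiff_adj]
      tauto
    rw [e]
    refine ⟨?_, hF.2⟩
    intro e
    induction e with
    | _ u v =>
      have h2 := F.ne_of_adj (a := u) (b := v)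
      simp only [mem_compEdges, Finset.mem_filter, Finset.mem_univ, true_and,
        SimpleGraph.mem_edgeSet, SimpleGraph.sdiff_adj]
      tauto
  · intro X hX
    have hX := Finset.mem_powerset.1 (Finset.mem_filter.1 hX).1
    ext e
    induction e with
    | _ u v =>
      rw [Finset.mem_filter, SimpleGraph.mem_edgeSet, addEdges_sdiff_adj hX]
      simp
  · intro F hF
    have hF := (Finset.mem_filter.1 hF).2
    ext u v
    have h1 := @hF.1 u v
    have h2 := F.ne_of_adj (a := u) (b := v)
    simp only [addEdges, SimpleGraph.sup_adj, SimpleGraph.fromEdgeSet_adj, Finset.mem_coe,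
      Finset.mem_filter, Finset.mem_univ, true_and, SimpleGraph.mem_edgeSet,
      SimpleGraph.sdiff_adj]
    tauto
  · intro X hX
    have hX := Finset.mem_powerset.1 (Finset.mem_filter.1 hX).1
    have h1 := edgeCount_addEdges hX
    have h2 := ncard_compEdges K
    have h3 := Finset.card_sdiff_add_card_eq_card hX
    congr 2
    · omega
    · convert (by omega : (compEdges K \ X).card = n.choose 2 - edgeCount (addEdges K X))

lemma prEvent_ge_of_bernPr_le {d : ℕ} {p q : ℝ} (hp0 : 0 ≤ p) (hp1 : p ≤ 1) (hq : 0 ≤ q)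
    {ν : PMF (SimpleGraph (Fin n) × SimpleGraph (Fin n))} (hν : IsRegAddGnp ν d p)
    (P : SimpleGraph (Fin n) × SimpleGraph (Fin n) → Prop)
    (h : ∀ K, IsRegularGraph K d → bernPr p (compEdges K) (fun X => ¬ P (K, addEdges K X)) ≤ q) :
    ENNReal.ofReal (1 - q) ≤ prEvent ν P := by
  have hsum : prEvent ν P + prEvent ν (fun w => ¬ P w) = 1 := by
    rw [← ν.tsum_coe]
    unfold prEvent
    rw [← ENNReal.tsum_add]
    refine tsum_congr fun w => ?_
    by_cases hw : P w <;> simp [hw]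
  have hbad : prEvent ν (fun w => ¬ P w) ≤ ENNReal.ofReal q := by
    set N : ℝ≥0∞ := ({G : SimpleGraph (Fin n) | IsRegularGraph G d}.ncard : ℝ≥0∞) with hN
    unfold prEvent
    rw [tsum_fintype, Fintype.sum_prod_type]
    calc _ ≤ ∑ K : SimpleGraph (Fin n),
          if IsRegularGraph K d then N⁻¹ * ENNReal.ofReal q else 0 := by
          refine Finset.sum_le_sum fun K _ => ?_
          split_ifs with hK
          · refine (Finset.sum_congr rfl fun F _ => (?_ : _ = N⁻¹ *
                if K ≤ F ∧ ¬ P (K, F) then ENNReal.ofReal (p ^ (edgeCount F - edgeCount K) *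
                  (1 - p) ^ (n.choose 2 - edgeCount F)) else 0)).trans_le ?_
            · rw [hν]
              by_cases h1 : K ≤ F <;> by_cases h2 : P (K, F) <;> simp [h1, h2, hK, hN]
            rw [← Finset.mul_sum, ← Finset.sum_filter, ← ENNReal.ofReal_sum_of_nonneg]
            · refine mul_le_mul_right (ENNReal.ofReal_le_ofReal ?_) _
              convert (sum_supergraphs_eq_bernPr p K fun F => ¬ P (K, F)).trans_le (h K hK)
            · intro F _
              have : 0 ≤ 1 - p := by linarith
              positivity
          · refine (Finset.sum_eq_zero fun F _ => ?_).le
            rw [hν]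
            simp [hK]
      _ = N * (N⁻¹ * ENNReal.ofReal q) := by
          rw [← Finset.sum_filter, Finset.sum_const, nsmul_eq_mul, hN]
          congr 2
          rw [← Set.ncard_coe_finset]
          congr 1
          ext K
          simp
      _ ≤ ENNReal.ofReal q := by
          rw [← mul_assoc]
          exact mul_le_of_le_one_left zero_le (ENNReal.mul_inv_le_one N)
  rw [ENNReal.ofReal_sub _ hq, ENNReal.ofReal_one, tsub_le_iff_right, ← hsum]
  gcongr

lemma prEvent_altPathCount_ge {d : ℕ} {p δ ρ : ℝ} (hn : 0 < n) (hL3 : 3 ≤ Real.log n)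
    (hdL : Real.log n ≤ d) (hδ : 1 ≤ δ) (hρ : 0 < ρ) (hρ1 : ρ ≤ 1 / 10000)
    (hL : δ * ρ ^ 4 = Real.log n) (hsmall : (δ + 1) * (d + 1) ≤ √n)
    (hp : p * (n - 1 - d) = δ)
    {ν : PMF (SimpleGraph (Fin n) × SimpleGraph (Fin n))} (hν : IsRegAddGnp ν d p) :
    ENNReal.ofReal (1 - 20 * Real.exp (-(11 * Real.log n))) ≤
      prEvent ν (fun w => ∀ x y : Fin n, ∀ ℓ : ℕ, Real.log n ≤ (ℓ : ℝ) →
        (ℓ : ℝ) ≤ 10 * Real.log n →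
        (altPathCount (w.2 \ w.1) w.1 (2 * ℓ) x y ∅ : ℝ) ≤
          (1 + 4000 * ρ) * (d : ℝ) ^ ℓ * δ ^ ℓ / n) := by
  have hn1 : (1 : ℝ) ≤ n := by exact_mod_cast hn
  have hn0 : (0 : ℝ) < n := by linarith
  have hd0 : (0 : ℝ) ≤ d := Nat.cast_nonneg d
  have hsq : √(n : ℝ) * √n = n := Real.mul_self_sqrt hn0.le
  have hs1 : 1 ≤ √(n : ℝ) := Real.one_le_sqrt.2 hn1
  have hsn : √(n : ℝ) ≤ n := by nlinarith
  have hpos : 0 < (n : ℝ) - 1 - d := by nlinarith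
  have hp0 : 0 ≤ p := by
    by_contra! h
    nlinarith
  have hpn : p * n ≤ δ + 1 := by
    by_contra! h
    have h1 := mul_lt_mul_of_pos_right h hpos
    nlinarith
  have hps : p * √n * (d + 1) ≤ 1 := by
    have h1 : p * √n * √n ≤ δ + 1 := by rw [mul_assoc, hsq]; exact hpn
    have h2 := mul_le_mul_of_nonneg_right h1 (by linarith : (0 : ℝ) ≤ d + 1)
    by_contra! h
    have h3 := mul_lt_mul_of_pos_right h (by linarith : 0 < √(n : ℝ))
    linarith
  have hp1 : p ≤ 1 := by
    have h1 : p ≤ p * √n := le_mul_of_one_le_right hp0 hs1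
    have h2 : p * √n ≤ p * √n * (d + 1) :=
      le_mul_of_one_le_right (by positivity) (by linarith)
    linarith
  have hpd : p * d * Real.exp (Real.log n / 2) ≤ 2 := by
    rw [Real.exp_half, Real.exp_log hn0]
    have : 0 ≤ p * √n := by positivity
    linarith
  have hρ2 : ρ ^ 2 ≤ 1 / 10000 * ρ := by nlinarith
  refine prEvent_ge_of_bernPr_le hp0 hp1 (by positivity) hν _ fun K hK => ?_
  refine le_trans (bernPr_mono hp0 hp1 fun X hX hbad => ?_)
    (bernPr_atypical_le hn hK hp0 hp1 hδ (sq_nonneg ρ) (by linarith)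
      (by rw [← hL]; ring) hpn hpd fun u v h => (mem_compEdges.1 h).2)
  by_contra! hgood
  obtain ⟨hdisc, hdeg, hcodeg, hsec⟩ := hgood
  refine hbad fun x y ℓ hℓ hℓ2 => ?_
  refine le_trans (Nat.cast_le.2 (altPathCount_le_altWalks _ _ _ x y)) ?_
  exact altWalks_le_of_typical hn hK (addEdges_sdiff_adj hX) hp0 hδ hρ hρ1 hL hL3 hpn hdL
    (fun S T hS hT => (hdisc S T hS hT).le) (fun x => (hdeg x).le)
    (fun x => (hsec x fun w => (hcodeg (x, w)).le).le) ℓ hℓ hℓ2 x y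

lemma exists_pow_four_eq {r s : ℝ} (hr : 0 < r) (hs : 0 ≤ s) (hrs : r ≤ s ^ 4) :
    ∃ ρ, 0 < ρ ∧ ρ ≤ s ∧ ρ ^ 4 = r := by
  have h : (r ^ ((1 : ℝ) / 4)) ^ 4 = r := by
    rw [← Real.rpow_natCast, ← Real.rpow_mul hr.le]
    norm_num
  refine ⟨r ^ ((1 : ℝ) / 4), by positivity, ?_, h⟩
  refine le_of_pow_le_pow_left₀ four_ne_zero hs ?_
  rw [h]
  exact hrs

lemma le_rpow_eighth {ρ : ℝ} (hρ : 0 < ρ) (hρ1 : ρ ≤ 1) :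
    ρ ≤ (2 * ρ ^ 4) ^ ((1 : ℝ) / 8) := by
  have h : (ρ ^ 8) ^ ((1 : ℝ) / 8) = ρ := by
    rw [← Real.rpow_natCast, ← Real.rpow_mul hρ.le]
    norm_num
  nth_rewrite 1 [← h]
  refine Real.rpow_le_rpow (by positivity) ?_ (by norm_num)
  have := pow_le_one₀ (n := 4) hρ.le hρ1
  have h4 : 0 < ρ ^ 4 := by positivity
  nlinarith

lemma degree_product_le {N D M ε σ δ : ℝ} (hN : 1 ≤ N) (hε : 0 < ε) (hε1 : ε ≤ 1)
    (hσ : σ ≤ 1 / 10) (hlow : ε * D * N / 2 ≤ M) (hup : M ≤ N ^ (1 + σ)) (hδ : δ = 2 * M / N)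
    (hD : 0 ≤ D) (hbig : 9 / ε ≤ N ^ ((3 : ℝ) / 10)) : (δ + 1) * (D + 1) ≤ √N := by
  have hN0 : 0 < N := by linarith
  set r := N ^ ((1 : ℝ) / 10) with hr
  have hr1 : 1 ≤ r := Real.one_le_rpow hN (by norm_num)
  have h1 : M ≤ N * r := by
    refine hup.trans ?_
    rw [Real.rpow_add hN0, Real.rpow_one]
    exact mul_le_mul_of_nonneg_left (Real.rpow_le_rpow_of_exponent_le hN hσ) hN0.le
  have h2 : δ ≤ 2 * r := by
    rw [hδ, div_le_iff₀ hN0]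
    linarith
  have h3 : ε * D ≤ 2 * r := by
    by_contra! h
    have := mul_lt_mul_of_pos_right h hN0
    nlinarith
  have h4 : ε * (D + 1) ≤ 3 * r := by linarith
  have hs : √N = N ^ ((3 : ℝ) / 10) * (r * r) := by
    rw [hr, Real.sqrt_eq_rpow, ← Real.rpow_add hN0, ← Real.rpow_add hN0]
    norm_num
  rw [div_le_iff₀ hε] at hbig
  rw [hs]
  have h5 : (δ + 1) * (ε * (D + 1)) ≤ 3 * r * (3 * r) :=
    mul_le_mul (by linarith) h4 (by positivity) (by positivity)
  have h6 : 9 * (r * r) ≤ N ^ ((3 : ℝ) / 10) * ε * (r * r) :=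
    mul_le_mul_of_nonneg_right hbig (by positivity)
  refine le_of_mul_le_mul_left ?_ hε
  linarith

lemma prEvent_mono {α : Type*} (μ : PMF α) {P Q : α → Prop} (h : ∀ a, P a → Q a) :
    prEvent μ P ≤ prEvent μ Q := by
  refine ENNReal.tsum_le_tsum fun a => ?_
  by_cases hP : P a
  · rw [if_pos hP, if_pos (h a hP)]
  · rw [if_neg hP]
    exact zero_le

/-- **Lemma 7.1.** There is `c* > 0` such that for every `ε ∈ (0,1]` there is `C₀ > 0`
such that for every sufficiently small `μ > 0` and every `σ ∈ (0,c*]` there is `C > 0`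
such that for every `c > 0` and all sufficiently large `n`: with `d ∈ [n]`,
`d ≥ C log n`, `dn` even, `ε d n/2 ≤ m ≤ n^{1+σ}`, `δ = 2m/n`,
`η = C₀ max{μ/log n, (n log n/m)^{1/8}}`, `p = m(binom(n,2) − dn/2)⁻¹`, and `(K,F)` with
`K ~ G_d(n)`, `F = K + E`, with probability at least `1 − c n⁻¹⁰`: for all distinct
`x, y ∈ [n]` and every integer `log n ≤ ℓ ≤ 10 log n`, the number of `(F∖K,K)`-alternating
`x,y`-paths of length `2ℓ` is at most `(1+η)·d^ℓ δ^ℓ/n`. -/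
theorem upper_bound_switching_paths :
    ∃ cstar : ℝ, 0 < cstar ∧
      ∀ ε : ℝ, 0 < ε → ε ≤ 1 →
        ∃ C₀ : ℝ, 0 < C₀ ∧
          ∃ μ₀ : ℝ, 0 < μ₀ ∧
            ∀ μ : ℝ, 0 < μ → μ ≤ μ₀ →
              ∀ σ : ℝ, 0 < σ → σ ≤ cstar →
                ∃ C : ℝ, 0 < C ∧
                  ∀ c : ℝ, 0 < c →
                    ∃ n₀ : ℕ, ∀ n : ℕ, n₀ ≤ n →
                      ∀ d m : ℕ, 1 ≤ d → d ≤ n → C * Real.log n ≤ (d : ℝ) →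
                        Even (d * n) →
                        ε * d * n / 2 ≤ (m : ℝ) → (m : ℝ) ≤ (n : ℝ) ^ ((1 : ℝ) + σ) →
                        ∀ δ η p : ℝ, δ = 2 * (m : ℝ) / n →
                          η = C₀ * max (μ / Real.log n)
                            (((n : ℝ) * Real.log n / m) ^ ((1 : ℝ) / 8)) →
                          p = (m : ℝ) / ((n.choose 2 : ℝ) - d * n / 2) →
                          ∀ ν : PMF (SimpleGraph (Fin n) × SimpleGraph (Fin n)),
                            IsRegAddGnp ν d p →
                            ENNReal.ofReal (1 - c / (n : ℝ) ^ 10) ≤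
                              prEvent ν (fun w =>
                                ∀ x y : Fin n, x ≠ y →
                                  ∀ ℓ : ℕ, Real.log n ≤ (ℓ : ℝ) →
                                    (ℓ : ℝ) ≤ 10 * Real.log n →
                                    (altPathCount (w.2 \ w.1) w.1 (2 * ℓ) x y ∅ : ℝ) ≤
                                      (1 + η) * (d : ℝ) ^ ℓ * δ ^ ℓ / n) := by
  refine ⟨1 / 10, by norm_num, fun ε hε hε1 => ⟨4000, by norm_num, 1, one_pos,
    fun μ _ _ σ _ hσ => ⟨10 ^ 16 / ε, by positivity, fun c hc => ?_⟩⟩⟩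
  have hev : ∀ᶠ n : ℕ in Filter.atTop, 3 ≤ Real.log n ∧ 9 / ε ≤ (n : ℝ) ^ ((3 : ℝ) / 10) ∧
      20 / c ≤ (n : ℝ) := by
    have hcast := tendsto_natCast_atTop_atTop (R := ℝ)
    exact ((Real.tendsto_log_atTop.comp hcast).eventually_ge_atTop 3).and
      ((((tendsto_rpow_atTop (by norm_num)).comp hcast).eventually_ge_atTop (9 / ε)).and
        (hcast.eventually_ge_atTop (20 / c)))
  obtain ⟨n₀, hn₀⟩ := Filter.eventually_atTop.1 hev
  refine ⟨n₀, fun n hn d m hd1 _ hdC _ hlow hup δ η p hδ hη hp ν hν => ?_⟩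
  obtain ⟨hL3, hbig, hcn⟩ := hn₀ n hn
  have hnpos : 0 < n := by
    rcases Nat.eq_zero_or_pos n with rfl | h
    · norm_num at hL3
    · exact h
  have hn1 : (1 : ℝ) ≤ n := by exact_mod_cast hnpos
  have hn0 : (0 : ℝ) < n := by linarith
  have hd1' : (1 : ℝ) ≤ d := by exact_mod_cast hd1
  set L := Real.log n with hLdef
  have hεd : 10 ^ 16 * L ≤ ε * d := by
    rw [div_mul_eq_mul_div, div_le_iff₀ hε] at hdC
    linarith
  have hδd : ε * d ≤ δ := by
    rw [hδ, le_div_iff₀ hn0]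
    linarith
  have hdL : L ≤ d := by nlinarith
  have hδ1 : 1 ≤ δ := by linarith
  have hδ0 : 0 < δ := by linarith
  have hsmall := degree_product_le hn1 hε hε1 hσ hlow hup hδ (by linarith) hbig
  obtain ⟨ρ, hρ, hρ1, hρ4⟩ := exists_pow_four_eq (r := L / δ) (s := 1 / 10000)
    (div_pos (by linarith) hδ0) (by norm_num) (by
      rw [div_le_iff₀ hδ0]
      norm_num
      linarith)
  have hsn : √(n : ℝ) ≤ n := by
    have h1 : 1 ≤ √(n : ℝ) := Real.one_le_sqrt.2 hn1
    have h2 : √(n : ℝ) * √n = n := Real.mul_self_sqrt hn0.le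
    nlinarith
  have hpos : 0 < (n : ℝ) - 1 - d := by nlinarith
  have hpδ : p * (n - 1 - d) = δ := by
    have e : (n.choose 2 : ℝ) - d * n / 2 = n * (n - 1 - d) / 2 := by
      rw [Nat.cast_choose_two]
      ring
    rw [hp, hδ, e]
    field_simp
  have hηρ : 4000 * ρ ≤ η := by
    rw [hη]
    refine mul_le_mul_of_nonneg_left (le_trans ?_ (le_max_right _ _)) (by norm_num)
    have e : (n : ℝ) * L / m = 2 * ρ ^ 4 := by
      have hm : (0 : ℝ) < m := by
        have : 0 < ε * d * n / 2 := by positivity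
        linarith
      rw [hρ4, hδ]
      field_simp
    rw [e]
    exact le_rpow_eighth hρ (by linarith)
  refine le_trans ?_ ((prEvent_altPathCount_ge hnpos hL3 hdL hδ1 hρ hρ1
    (by rw [hρ4, ← hLdef]; field_simp) hsmall hpδ hν).trans (prEvent_mono ν fun w hw x y _ ℓ h1 h2 => ?_))
  · refine ENNReal.ofReal_le_ofReal (sub_le_sub_left ?_ 1)
    have e : Real.exp (-(11 * L)) = 1 / (n : ℝ) ^ 11 := by
      rw [Real.exp_neg, show 11 * L = (11 : ℕ) * L by norm_num, Real.exp_nat_mul,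
        Real.exp_log hn0, one_div]
    rw [← hLdef, e, mul_one_div, div_le_div_iff₀ (by positivity) (by positivity)]
    rw [div_le_iff₀ hc] at hcn
    calc 20 * (n : ℝ) ^ 10 ≤ n * c * n ^ 10 :=
          mul_le_mul_of_nonneg_right hcn (by positivity)
      _ = c * n ^ 11 := by ring
  · refine (hw x y ℓ h1 h2).trans (div_le_div_of_nonneg_right ?_ hn0.le)
    gcongr

end Sandwich
end
end
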